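/- arXiv:1406.5516 — 3 statements merged into one kernel-verified Lean document; each statement's English description precedes it below -/
import Mathlib

section
/- Mergelyan's theorem: let K be a compact subset of the complex plane ℂ such that ℂ \ K is connected, and let f : K → ℂ be continuous on K and holomorphic in the interior of K. Then for every ε > 0 there exists a complex polynomial p such that sup_{z ∈ K} |f(z) − p(z)| < ε. -/
open Set Filter Topology Metric MeasureTheory

/-- `f` is a uniform limit of polynomials on `K`. -/
def PolyApprox (K : Set ℂ) (f : ℂ → ℂ) : Prop :=
  ∀ ε > 0, ∃ p : Polynomial ℂ, ∀ z ∈ K, ‖f z - p.eval z‖ < ε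

namespace PolyApprox

variable {K : Set ℂ} {f g : ℂ → ℂ}

theorem congr (hf : PolyApprox K f) (h : ∀ z ∈ K, f z = g z) : PolyApprox K g := by
  intro ε hε
  obtain ⟨p, hp⟩ := hf ε hε
  exact ⟨p, fun z hz ↦ h z hz ▸ hp z hz⟩

theorem polynomial (p : Polynomial ℂ) : PolyApprox K fun z ↦ p.eval z :=
  fun ε hε ↦ ⟨p, fun z _ ↦ by simpa using hε⟩

theorem const (c : ℂ) : PolyApprox K fun _ ↦ c := by
  simpa using polynomial (K := K) (Polynomial.C c)

theorem id : PolyApprox K fun z ↦ z := by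
  simpa using polynomial (K := K) Polynomial.X

theorem of_forall_exists
    (h : ∀ ε > 0, ∃ g, PolyApprox K g ∧ ∀ z ∈ K, ‖f z - g z‖ < ε) : PolyApprox K f := by
  intro ε hε
  obtain ⟨g, hg, hfg⟩ := h (ε / 2) (by positivity)
  obtain ⟨p, hp⟩ := hg (ε / 2) (by positivity)
  refine ⟨p, fun z hz ↦ ?_⟩
  have := norm_sub_le_norm_sub_add_norm_sub (f z) (g z) (p.eval z)
  linarith [hfg z hz, hp z hz]

theorem add (hf : PolyApprox K f) (hg : PolyApprox K g) : PolyApprox K fun z ↦ f z + g z := by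
  intro ε hε
  obtain ⟨p, hp⟩ := hf (ε / 2) (by positivity)
  obtain ⟨q, hq⟩ := hg (ε / 2) (by positivity)
  refine ⟨p + q, fun z hz ↦ ?_⟩
  rw [Polynomial.eval_add, add_sub_add_comm]
  linarith [norm_add_le (f z - p.eval z) (g z - q.eval z), hp z hz, hq z hz]

theorem exists_norm_le (hK : IsCompact K) (hf : PolyApprox K f) :
    ∃ C > 0, ∀ z ∈ K, ‖f z‖ ≤ C := by
  obtain ⟨p, hp⟩ := hf 1 one_pos
  obtain ⟨C, hC⟩ := hK.exists_bound_of_continuousOn (f := fun z ↦ p.eval z) p.continuous.continuousOn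
  refine ⟨|C| + 1, by positivity, fun z hz ↦ ?_⟩
  have := norm_le_norm_add_norm_sub' (f z) (p.eval z)
  linarith [hp z hz, hC z hz, le_abs_self C]

theorem eval_mul (hK : IsCompact K) (p : Polynomial ℂ) (hf : PolyApprox K f) :
    PolyApprox K fun z ↦ p.eval z * f z := by
  intro ε hε
  obtain ⟨C, hC0, hC⟩ := (polynomial (K := K) p).exists_norm_le hK
  obtain ⟨q, hq⟩ := hf (ε / C) (by positivity)
  refine ⟨p * q, fun z hz ↦ ?_⟩
  rw [Polynomial.eval_mul, ← mul_sub, norm_mul]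
  calc _ ≤ C * ‖f z - q.eval z‖ := by gcongr; exact hC z hz
    _ < C * (ε / C) := by gcongr; exact hq z hz
    _ = ε := by field_simp

theorem mul (hK : IsCompact K) (hf : PolyApprox K f) (hg : PolyApprox K g) :
    PolyApprox K fun z ↦ f z * g z := by
  refine of_forall_exists fun ε hε ↦ ?_
  obtain ⟨C, hC0, hC⟩ := hg.exists_norm_le hK
  obtain ⟨p, hp⟩ := hf (ε / C) (by positivity)
  refine ⟨_, hg.eval_mul hK p, fun z hz ↦ ?_⟩
  rw [← sub_mul, norm_mul]
  calc _ ≤ ‖f z - p.eval z‖ * C := by gcongr; exact hC z hz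
    _ < ε / C * C := by gcongr; exact hp z hz
    _ = ε := by field_simp

theorem pow (hK : IsCompact K) (hf : PolyApprox K f) (n : ℕ) : PolyApprox K fun z ↦ f z ^ n := by
  induction n with
  | zero => simpa using const 1
  | succ n ih => simpa only [pow_succ] using ih.mul hK hf

theorem const_mul (hK : IsCompact K) (c : ℂ) (hf : PolyApprox K f) :
    PolyApprox K fun z ↦ c * f z :=
  (const c).mul hK hf

theorem sub (hK : IsCompact K) (hf : PolyApprox K f) (hg : PolyApprox K g) :
    PolyApprox K fun z ↦ f z - g z := by
  simpa [sub_eq_add_neg] using hf.add (hg.const_mul hK (-1))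

theorem sum {ι : Type*} (s : Finset ι) {F : ι → ℂ → ℂ} (h : ∀ i ∈ s, PolyApprox K (F i)) :
    PolyApprox K fun z ↦ ∑ i ∈ s, F i z := by
  classical
  induction s using Finset.induction_on with
  | empty => simpa using const 0
  | insert a s ha ih =>
    simp only [Finset.sum_insert ha]
    exact (h a (by simp)).add (ih fun i hi ↦ h i (by simp [hi]))

theorem comp_of_differentiableOn (hK : IsCompact K) (hf : PolyApprox K f) {φ : ℂ → ℂ} {c : ℂ}
    {r R : ℝ} (hr : 0 ≤ r) (hrR : r < R) (hφ : DifferentiableOn ℂ φ (closedBall c R))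
    (h : ∀ z ∈ K, ‖f z - c‖ < r) : PolyApprox K fun z ↦ φ (f z) := by
  lift r to NNReal using hr
  lift R to NNReal using r.2.trans hrR.le
  have hR : 0 < R := lt_of_le_of_lt (zero_le) (by exact_mod_cast hrR)
  have := (hφ.hasFPowerSeriesOnBall hR).tendstoUniformlyOn' (r' := r) (by exact_mod_cast hrR)
  refine of_forall_exists fun ε hε ↦ ?_
  obtain ⟨n, hn⟩ := (Metric.tendstoUniformlyOn_iff.1 this ε hε).exists
  refine ⟨fun z ↦ (cauchyPowerSeries φ c R).partialSum n (f z - c), ?_, fun z hz ↦ ?_⟩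
  · simp only [FormalMultilinearSeries.partialSum,
      FormalMultilinearSeries.apply_eq_pow_smul_coeff, smul_eq_mul]
    exact sum _ fun i _ ↦ ((hf.sub hK (const c)).pow hK i).mul hK (const _)
  · simpa [dist_eq_norm] using hn (f z) (by simpa [dist_eq_norm] using h z hz)

end PolyApprox

/-- Propagation along a connected complement: a property stable under small moves, and whose
limit points in `Kᶜ` stay in the open set `V`, holds throughout `Kᶜ`. -/
theorem compl_subset_of_step {K V P : Set ℂ} (hK : IsClosed K) (hKc : IsPreconnected Kᶜ)
    (hV : IsOpen V) (hPV : P ⊆ Kᶜ ∩ V) (hP : P.Nonempty) (hcl : closure P ∩ Kᶜ ⊆ V)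
    (step : ∀ y ∈ P, ∀ y' ∈ Kᶜ ∩ V, (∀ z ∈ K, ‖y' - y‖ ≤ ‖z - y‖ / 2) → y' ∈ P) :
    Kᶜ ⊆ P := by
  have key : ∀ a ∈ Kᶜ ∩ V, ∃ ρ > 0, ∀ y ∈ P, ∀ y' ∈ Kᶜ ∩ V, dist y a < ρ → dist y' a < ρ →
      y' ∈ P := by
    intro a ha
    obtain ⟨ρ, hρ, hρK⟩ := Metric.isOpen_iff.1 hK.isOpen_compl a ha.1
    refine ⟨ρ / 5, by positivity, fun y hy y' hy' hya hy'a ↦ step y hy y' hy' fun z hz ↦ ?_⟩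
    have h1 : ρ ≤ dist z a := by
      by_contra hlt
      exact hρK (mem_ball.2 (not_le.1 hlt)) hz
    rw [← dist_eq_norm, ← dist_eq_norm]
    have h2 := dist_triangle z y a
    have h3 := dist_triangle_right y' y a
    linarith
  refine hKc.subset_of_closure_inter_subset ?_ ?_ ?_
  · rw [Metric.isOpen_iff]
    intro a ha
    obtain ⟨ρ, hρ, h⟩ := key a (hPV ha)
    obtain ⟨σ, hσ, hσV⟩ := Metric.isOpen_iff.1 (hK.isOpen_compl.inter hV) a (hPV ha)
    refine ⟨min ρ σ, lt_min hρ hσ, fun b hb ↦ ?_⟩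
    have hb' := mem_ball.1 hb
    exact h a ha b (hσV (mem_ball.2 (hb'.trans_le (min_le_right _ _)))) (by simpa using hρ)
      (hb'.trans_le (min_le_left _ _))
  · obtain ⟨a, ha⟩ := hP
    exact ⟨a, (hPV ha).1, ha⟩
  · rintro a ⟨haP, haK⟩
    have haV : a ∈ Kᶜ ∩ V := ⟨haK, hcl ⟨haP, haK⟩⟩
    obtain ⟨ρ, hρ, h⟩ := key a haV
    obtain ⟨b, hb, hab⟩ := Metric.mem_closure_iff.1 haP ρ hρ
    exact h b hb a haV (by rwa [dist_comm]) (by simpa using hρ)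

theorem PolyApprox.inv_one_sub {K : Set ℂ} (hK : IsCompact K) {f : ℂ → ℂ} (hf : PolyApprox K f)
    (h : ∀ z ∈ K, ‖f z‖ ≤ 1 / 2) : PolyApprox K fun z ↦ (1 - f z)⁻¹ := by
  refine hf.comp_of_differentiableOn (φ := fun w ↦ (1 - w)⁻¹) (c := 0) (r := 2 / 3) (R := 3 / 4)
    hK (by norm_num) (by norm_num) ?_ fun z hz ↦ ?_
  · intro w hw
    have : (1 : ℂ) - w ≠ 0 := by
      intro h0
      have : w = 1 := by linear_combination -h0
      norm_num [this] at hw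
    exact ((differentiableAt_id.const_sub 1).inv this).differentiableWithinAt
  · rw [sub_zero]
    linarith [h z hz]

theorem PolyApprox.cpow_half {K : Set ℂ} (hK : IsCompact K) {f : ℂ → ℂ} (hf : PolyApprox K f)
    (h : ∀ z ∈ K, ‖f z - 1‖ ≤ 1 / 2) : PolyApprox K fun z ↦ f z ^ (2⁻¹ : ℂ) := by
  refine hf.comp_of_differentiableOn (φ := fun w ↦ w ^ (2⁻¹ : ℂ)) (c := 1) (r := 2 / 3)
    (R := 3 / 4) hK (by norm_num) (by norm_num) ?_ fun z hz ↦ ?_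
  · intro w hw
    have hw' : ‖w - 1‖ ≤ 3 / 4 := by simpa [dist_eq_norm] using hw
    have h1 := (abs_le.1 (Complex.abs_re_le_norm (w - 1))).1
    have : w ∈ Complex.slitPlane := Or.inl (by simp at h1; linarith)
    exact (differentiableAt_id.cpow_const this).differentiableWithinAt
  · linarith [h z hz]

theorem polyApprox_inv_sub {K : Set ℂ} (hK : IsCompact K) (hKc : IsPreconnected Kᶜ) {a : ℂ}
    (ha : a ∉ K) : PolyApprox K fun z ↦ (z - a)⁻¹ := by
  obtain ⟨R, hR⟩ := hK.isBounded.exists_norm_le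
  refine (compl_subset_of_step (P := {a | a ∉ K ∧ PolyApprox K fun z ↦ (z - a)⁻¹}) (V := univ)
    hK.isClosed hKc isOpen_univ (fun a h ↦ ⟨h.1, trivial⟩) ?_ (fun _ _ ↦ trivial) ?_ ha).2
  · set b : ℂ := ((2 * (|R| + 1) : ℝ) : ℂ) with hb
    have hbn : ‖b‖ = 2 * (|R| + 1) := by
      rw [hb, Complex.norm_real, Real.norm_of_nonneg (by positivity)]
    have hb0 : b ≠ 0 := norm_pos_iff.1 (by rw [hbn]; positivity)
    have hRb : ∀ z ∈ K, ‖z‖ ≤ ‖b‖ / 2 := fun z hz ↦ by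
      rw [hbn]
      linarith [hR z hz, le_abs_self R]
    refine ⟨b, fun hbK ↦ ?_, ?_⟩
    · have := hRb b hbK
      have := norm_pos_iff.2 hb0
      linarith
    · have h1 : PolyApprox K fun z ↦ (1 - b⁻¹ * z)⁻¹ := by
        refine (PolyApprox.id.const_mul hK b⁻¹).inv_one_sub hK fun z hz ↦ ?_
        rw [norm_mul, norm_inv, inv_mul_le_iff₀ (norm_pos_iff.2 hb0)]
        linarith [hRb z hz]
      refine (h1.const_mul hK (-b⁻¹)).congr fun z hz ↦ ?_
      rw [neg_mul, ← mul_inv, ← inv_neg]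
      congr 1
      field_simp
      ring
  · rintro y ⟨hy, hyP⟩ y' ⟨hy', -⟩ hd
    refine ⟨hy', ?_⟩
    have h1 : PolyApprox K fun z ↦ (1 - (y' - y) * (z - y)⁻¹)⁻¹ := by
      refine (hyP.const_mul hK (y' - y)).inv_one_sub hK fun z hz ↦ ?_
      have : 0 < ‖z - y‖ := norm_pos_iff.2 (sub_ne_zero.2 fun h ↦ hy (h ▸ hz))
      rw [norm_mul, norm_inv, mul_inv_le_iff₀ this]
      linarith [hd z hz]
    refine (hyP.mul hK h1).congr fun z hz ↦ ?_
    have : z - y ≠ 0 := sub_ne_zero.2 fun h ↦ hy (h ▸ hz)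
    rw [← mul_inv]
    congr 1
    field_simp
    ring

theorem abs_im_lt_re_of_sq {s : ℂ} (h0 : 0 < s.re) (h : 0 < (s ^ 2).re) : |s.im| < s.re := by
  rw [← abs_of_pos h0]
  refine sq_lt_sq.1 ?_
  simp [pow_two] at h
  nlinarith

theorem abs_im_cpow_half_lt_re {u : ℂ} (h : 0 < u.re) :
    |(u ^ (2⁻¹ : ℂ)).im| < (u ^ (2⁻¹ : ℂ)).re := by
  refine abs_im_lt_re_of_sq ?_ ?_
  · rw [Complex.cpow_inv_two_re]
    exact Real.sqrt_pos.2 (by positivity)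
  · have := Complex.cpow_nat_inv_pow u two_ne_zero
    push_cast at this
    rwa [this]

/-- A branch on `K` of the square root of `(z - y) / (z - x)`, for some `y` at distance comparable
to `r` from `x`, which is near the principal branch away from `x`. -/
theorem exists_sqrt_branch {K : Set ℂ} (hK : IsCompact K) (hKc : IsPreconnected Kᶜ) {x : ℂ}
    (hx : x ∉ K) {r : ℝ} (hr : 0 < r) :
    ∃ (y : ℂ) (S : ℂ → ℂ), r / 2 ≤ ‖y - x‖ ∧ ‖y - x‖ < r ∧ PolyApprox K S ∧
      (∀ z ∈ K, (S z) ^ 2 * (z - x) = z - y) ∧ ∀ z ∈ K, 4 * r ≤ ‖z - x‖ → 0 < (S z).re := by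
  by_contra! hcon
  set P : Set ℂ := {y | y ∉ K ∧ ‖y - x‖ < r ∧ ∃ S, PolyApprox K S ∧
    (∀ z ∈ K, (S z) ^ 2 * (z - x) = z - y) ∧ ∀ z ∈ K, 4 * r ≤ ‖z - x‖ → 0 < (S z).re} with hPdef
  have hPr : P ⊆ closedBall x (r / 2) := by
    rintro y ⟨-, hyr, S, hS, hS2, hSre⟩
    rw [mem_closedBall, dist_eq_norm]
    by_contra! hlt
    obtain ⟨z, hz, h1, h2⟩ := hcon y S hlt.le hyr hS hS2
    linarith [hSre z hz h1]
  have hsub : Kᶜ ⊆ P := by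
    refine compl_subset_of_step (V := ball x r) hK.isClosed hKc isOpen_ball ?_ ?_ ?_ ?_
    · exact fun y hy ↦ ⟨hy.1, by simpa [dist_eq_norm] using hy.2.1⟩
    · exact ⟨x, hx, by simpa using hr, fun _ ↦ 1, PolyApprox.const 1, by simp, by simp⟩
    · rintro y ⟨hy, -⟩
      exact closedBall_subset_ball (by linarith) (closure_minimal hPr isClosed_closedBall hy)
    · rintro y ⟨hyK, hyr, S, hS, hS2, hSre⟩ y' ⟨hy'K, hy'r⟩ hd
      rw [mem_ball, dist_eq_norm] at hy'r
      have hne : ∀ z ∈ K, z - y ≠ 0 := fun z hz ↦ sub_ne_zero.2 fun h ↦ hyK (h ▸ hz)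
      set u : ℂ → ℂ := fun z ↦ 1 - (y' - y) * (z - y)⁻¹ with hu
      have hu2 : ∀ z, (u z ^ (2⁻¹ : ℂ)) ^ 2 = u z := fun z ↦ by
        simpa only [Nat.cast_ofNat] using Complex.cpow_nat_inv_pow (u z) two_ne_zero
      have huP : PolyApprox K u :=
        (PolyApprox.const 1).sub hK ((polyApprox_inv_sub hK hKc hyK).const_mul hK _)
      have hu1 : ∀ z ∈ K, ‖u z - 1‖ ≤ 1 / 2 := fun z hz ↦ by
        have : 0 < ‖z - y‖ := norm_pos_iff.2 (hne z hz)
        simp only [hu, sub_sub_cancel_left]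
        rw [norm_neg, norm_mul, norm_inv, mul_inv_le_iff₀ this]
        linarith [hd z hz]
      have hsq : ∀ z ∈ K, (S z * u z ^ (2⁻¹ : ℂ)) ^ 2 * (z - x) = z - y' := fun z hz ↦ by
        rw [mul_pow, hu2, mul_right_comm, hS2 z hz]
        simp only [hu]
        have := hne z hz
        field_simp
        ring
      refine ⟨hy'K, hy'r, fun z ↦ S z * u z ^ (2⁻¹ : ℂ), hS.mul hK (huP.cpow_half hK hu1), hsq,
        fun z hz h4 ↦ ?_⟩
      have hre : 0 < (u z).re := by
        have h1 := (abs_le.1 (Complex.abs_re_le_norm (u z - 1))).1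
        have h2 := hu1 z hz
        simp at h1
        linarith
      have hv := abs_im_cpow_half_lt_re hre
      have hSv : |(S z).im| < (S z).re := by
        refine abs_im_lt_re_of_sq (hSre z hz h4) ?_
        have hzx : 0 < ‖z - x‖ := by linarith
        have h1 : S z ^ 2 - 1 = -((y - x) * (z - x)⁻¹) := by
          have : z - x ≠ 0 := norm_pos_iff.1 hzx
          field_simp
          linear_combination hS2 z hz
        have h2 : ‖S z ^ 2 - 1‖ ≤ 1 / 2 := by
          rw [h1, norm_neg, norm_mul, norm_inv, mul_inv_le_iff₀ hzx]
          linarith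
        have h3 := (abs_le.1 (Complex.abs_re_le_norm (S z ^ 2 - 1))).1
        rw [Complex.sub_re, Complex.one_re] at h3
        linarith
      rw [Complex.mul_re]
      have h5 : (S z).im * (u z ^ (2⁻¹ : ℂ)).im ≤ |(S z).im| * |(u z ^ (2⁻¹ : ℂ)).im| := by
        rw [← abs_mul]
        exact le_abs_self _
      have h6 : |(S z).im| * |(u z ^ (2⁻¹ : ℂ)).im| < (S z).re * (u z ^ (2⁻¹ : ℂ)).re :=
        mul_lt_mul'' hSv hv (abs_nonneg _) (abs_nonneg _)
      linarith
  obtain ⟨R, hR⟩ := hK.isBounded.subset_closedBall x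
  have hfar : x + ((|R| + r + 1 : ℝ) : ℂ) ∈ P := by
    refine hsub fun hmem ↦ ?_
    have := hR hmem
    rw [mem_closedBall, dist_eq_norm, add_sub_cancel_left, Complex.norm_real,
      Real.norm_of_nonneg (by positivity)] at this
    linarith [le_abs_self R]
  have := hfar.2.1
  rw [add_sub_cancel_left, Complex.norm_real, Real.norm_of_nonneg (by positivity)] at this
  linarith [abs_nonneg R]

/-- An approximate Cauchy kernel, in the closure of the polynomials on `K`, with a cubic error
term at infinity. -/
theorem exists_approx_cauchy_kernel {K : Set ℂ} (hK : IsCompact K) (hKc : IsPreconnected Kᶜ)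
    {x : ℂ} (hx : x ∉ K) {r : ℝ} (hr : 0 < r) :
    ∃ (m : ℂ) (g : ℂ → ℂ), PolyApprox K g ∧ ∀ z ∈ K, ∀ ζ ∈ ball x r, z ≠ ζ →
      ‖g z + (ζ - m) * g z ^ 2 - (z - ζ)⁻¹‖ ≤ 10 ^ 8 * (‖z - ζ‖ * (1 + (‖z - ζ‖ / r) ^ 2))⁻¹ := by
  obtain ⟨y, S, hy1, hy2, hS, hS2, hSre⟩ := exists_sqrt_branch hK hKc hx hr
  set m : ℂ := (x + y) / 2 with hm
  set c : ℂ := (y - x) / 2 with hc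
  have hcn : ‖c‖ = ‖y - x‖ / 2 := by simp [hc]
  have hc0 : c ≠ 0 := norm_pos_iff.1 (by rw [hcn]; linarith)
  set g : ℂ → ℂ := fun z ↦ 2 * (c ^ 2)⁻¹ * (z - m - (z - x) * S z) with hg
  have hgP : PolyApprox K g := by
    refine PolyApprox.const_mul hK _ (PolyApprox.sub hK ?_ (PolyApprox.mul hK ?_ hS))
    · exact PolyApprox.id.sub hK (PolyApprox.const m)
    · exact PolyApprox.id.sub hK (PolyApprox.const x)
  refine ⟨m, g, hgP, fun z hz ζ hζ hzζ ↦ ?_⟩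
  rw [mem_ball, dist_eq_norm] at hζ
  have ht : 0 < ‖z - ζ‖ := norm_pos_iff.2 (sub_ne_zero.2 hzζ)
  have hT2 : ((z - x) * S z) ^ 2 = (z - x) * (z - y) := by
    linear_combination (z - x) * hS2 z hz
  set T := (z - x) * S z with hT
  have hmx : ‖x - m‖ ≤ r / 2 := by
    have : x - m = -c := by rw [hm, hc]; ring
    rw [this, norm_neg, hcn]
    linarith
  have hs : ‖ζ - m‖ ≤ 3 / 2 * r := by
    linarith [norm_sub_le_norm_sub_add_norm_sub ζ x m]
  have hzζ1 : ‖z - ζ‖ ≤ ‖z - x‖ + r := by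
    have := norm_sub_le_norm_sub_add_norm_sub z x ζ
    rw [norm_sub_rev x ζ] at this
    linarith
  have hden : 0 < ‖z - ζ‖ * (1 + (‖z - ζ‖ / r) ^ 2) := by positivity
  have hgz : g z = 2 * (c ^ 2)⁻¹ * (z - m - T) := rfl
  rw [← div_eq_mul_inv, le_div_iff₀ hden]
  rcases le_total (4 * r) ‖z - x‖ with hfar | hnear
  · set a := ‖z - x‖ with ha
    have ha0 : 0 < a := by linarith
    have hra : r / a ≤ 1 / 4 := by
      rw [div_le_iff₀ ha0]
      linarith
    have hw : a / 2 ≤ ‖z - m‖ := by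
      have := norm_sub_le_norm_sub_add_norm_sub z m x
      rw [norm_sub_rev m x] at this
      linarith
    have hwT : a / 2 ≤ ‖z - m + T‖ := by
      have h1 : z - m + T = (z - x) * (1 + S z) + (x - m) := by rw [hT]; ring
      have h2 : 1 ≤ ‖1 + S z‖ := by
        refine le_trans ?_ (Complex.re_le_norm _)
        simpa using (hSre z hz hfar).le
      have h3 : a ≤ ‖(z - x) * (1 + S z)‖ := by
        rw [norm_mul]
        exact le_mul_of_one_le_right ha0.le h2
      rw [h1]
      have := norm_sub_le_norm_add ((z - x) * (1 + S z)) (x - m)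
      linarith
    have hv : a / 2 ≤ ‖z - ζ‖ := by
      have := norm_sub_le_norm_sub_add_norm_sub z ζ x
      linarith
    have hinv : ∀ u : ℂ, a / 2 ≤ ‖u‖ → u ≠ 0 ∧ ‖u⁻¹‖ ≤ 2 / a := fun u hu ↦ by
      refine ⟨norm_pos_iff.1 (by linarith), ?_⟩
      rw [norm_inv, ← inv_div]
      exact inv_anti₀ (by positivity) hu
    obtain ⟨hw0, hp⟩ := hinv _ hw
    obtain ⟨hwT0, hq⟩ := hinv _ hwT
    obtain ⟨hv0, hv⟩ := hinv _ hv
    set p := (z - m)⁻¹ with hpdef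
    set q := (z - m + T)⁻¹ with hqdef
    set v := (z - ζ)⁻¹ with hvdef
    have hgq : g z = 2 * q := by
      rw [hgz, hqdef]
      field_simp
      rw [hc, hm] at *
      linear_combination -hT2
    have hgp : g z - p = c ^ 2 * p * q ^ 2 := by
      rw [hgq, hpdef, hqdef]
      field_simp
      rw [hc, hm] at *
      linear_combination -hT2
    have hvp : v = p + (ζ - m) * p ^ 2 + (ζ - m) ^ 2 * p ^ 2 * v := by
      rw [hvdef, hpdef]
      field_simp
      ring
    have hE : ‖g z - p‖ ≤ 2 * (r ^ 2 / a ^ 3) := by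
      rw [hgp, norm_mul, norm_mul, norm_pow, norm_pow]
      have : ‖c‖ ≤ r / 2 := by rw [hcn]; linarith
      calc _ ≤ (r / 2) ^ 2 * (2 / a) * (2 / a) ^ 2 := by gcongr
        _ = _ := by field_simp
    have hgn : ‖g z + p‖ ≤ 6 / a := by
      rw [hgq]
      refine (norm_add_le _ _).trans ?_
      rw [norm_mul, RCLike.norm_ofNat]
      calc _ ≤ 2 * (2 / a) + 2 / a := by gcongr
        _ = _ := by ring
    have hQ : g z + (ζ - m) * g z ^ 2 - v =
        (g z - p) + (ζ - m) * (g z - p) * (g z + p) - (ζ - m) ^ 2 * p ^ 2 * v := by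
      linear_combination -hvp
    have h2 : ‖(ζ - m) * (g z - p) * (g z + p)‖ ≤ 5 * (r ^ 2 / a ^ 3) := by
      rw [norm_mul, norm_mul]
      calc _ ≤ (3 / 2 * r) * (2 * (r ^ 2 / a ^ 3)) * (6 / a) := by gcongr
        _ = 18 * (r / a) * (r ^ 2 / a ^ 3) := by field_simp; ring
        _ ≤ 18 * (1 / 4) * (r ^ 2 / a ^ 3) := by gcongr
        _ ≤ _ := by gcongr; norm_num
    have h3 : ‖(ζ - m) ^ 2 * p ^ 2 * v‖ ≤ 18 * (r ^ 2 / a ^ 3) := by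
      rw [norm_mul, norm_mul, norm_pow, norm_pow]
      calc _ ≤ (3 / 2 * r) ^ 2 * (2 / a) ^ 2 * (2 / a) := by gcongr
        _ = _ := by field_simp; ring
    have h4 : ‖g z + (ζ - m) * g z ^ 2 - v‖ ≤ 25 * (r ^ 2 / a ^ 3) := by
      rw [hQ]
      have := norm_sub_le (g z - p + (ζ - m) * (g z - p) * (g z + p)) ((ζ - m) ^ 2 * p ^ 2 * v)
      have := norm_add_le (g z - p) ((ζ - m) * (g z - p) * (g z + p))
      linarith
    have h5 : ‖z - ζ‖ * (1 + (‖z - ζ‖ / r) ^ 2) ≤ 10 * (a ^ 3 / r ^ 2) := by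
      have h6 : ‖z - ζ‖ ≤ 2 * a := by linarith
      have h7 : 1 ≤ (a / r) ^ 2 := by
        refine one_le_pow₀ ?_
        rw [le_div_iff₀ hr]
        linarith
      calc _ ≤ (2 * a) * ((a / r) ^ 2 + (2 * a / r) ^ 2) := by gcongr
        _ = _ := by field_simp; ring
    calc _ ≤ 25 * (r ^ 2 / a ^ 3) * (10 * (a ^ 3 / r ^ 2)) := by gcongr
      _ = 250 := by field_simp; norm_num
      _ ≤ _ := by norm_num
  · have hTn : ‖T‖ ≤ 5 * r := by
      have h1 : ‖T‖ ^ 2 ≤ (5 * r) ^ 2 := by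
        rw [← norm_pow, hT2, norm_mul]
        have : ‖z - y‖ ≤ 5 * r := by
          have := norm_sub_le_norm_sub_add_norm_sub z x y
          rw [norm_sub_rev x y] at this
          linarith
        calc _ ≤ (5 * r) * (5 * r) := by gcongr; linarith
          _ = _ := by ring
      exact le_of_sq_le_sq h1 (by positivity)
    have hgn : ‖g z‖ ≤ 320 / r := by
      have h1 : ‖z - m - T‖ ≤ 10 * r := by
        have := norm_sub_le (z - m) T
        have := norm_sub_le_norm_sub_add_norm_sub z x m
        linarith
      have h2 : r / 4 ≤ ‖c‖ := by rw [hcn]; linarith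
      rw [hgz, norm_mul, norm_mul, norm_inv, norm_pow, RCLike.norm_ofNat]
      calc _ ≤ 2 * ((r / 4) ^ 2)⁻¹ * (10 * r) := by gcongr
        _ = _ := by field_simp; norm_num
    have h5r : ‖z - ζ‖ ≤ 5 * r := by linarith
    have hQ : ‖g z + (ζ - m) * g z ^ 2‖ ≤ 153920 / r := by
      refine (norm_add_le _ _).trans ?_
      rw [norm_mul (ζ - m), norm_pow]
      calc _ ≤ 320 / r + (3 / 2 * r) * (320 / r) ^ 2 := by gcongr
        _ = _ := by field_simp; norm_num
    have h1 : ‖g z + (ζ - m) * g z ^ 2 - (z - ζ)⁻¹‖ * ‖z - ζ‖ ≤ 769601 := by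
      calc _ ≤ (153920 / r + ‖z - ζ‖⁻¹) * ‖z - ζ‖ := by
            gcongr
            refine (norm_sub_le _ _).trans ?_
            rw [norm_inv]
            gcongr
        _ = 153920 / r * ‖z - ζ‖ + 1 := by field_simp
        _ ≤ 153920 / r * (5 * r) + 1 := by gcongr
        _ = _ := by field_simp; norm_num
    have h2 : 1 + (‖z - ζ‖ / r) ^ 2 ≤ 26 := by
      have : ‖z - ζ‖ / r ≤ 5 := by rwa [div_le_iff₀ hr]
      calc _ ≤ 1 + (5 : ℝ) ^ 2 := by gcongr
        _ = _ := by norm_num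
    rw [← mul_assoc]
    calc _ ≤ (769601 : ℝ) * 26 := by gcongr
      _ ≤ _ := by norm_num

open Real in
theorem intervalIntegral_circle_smul_eq_circleAverage {E : Type*} [NormedAddCommGroup E]
    [NormedSpace ℝ E] (G : ℂ → E) (w : ℂ) :
    ∫ θ in (0 : ℝ)..2 * π, G (Circle.exp θ * w) = (2 * π) • circleAverage G 0 ‖w‖ := by
  have h1 : ∀ θ : ℝ, (Circle.exp θ : ℂ) * w = circleMap 0 ‖w‖ (θ + Complex.arg w) := fun θ ↦ by
    conv_lhs => rw [← Complex.norm_mul_exp_arg_mul_I w]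
    rw [Circle.coe_exp, circleMap, zero_add, Complex.ofReal_add, add_mul, Complex.exp_add]
    ring
  have hper : Function.Periodic (fun θ ↦ G (circleMap 0 ‖w‖ θ)) (2 * π) := fun θ ↦ by
    simp only [periodic_circleMap 0 ‖w‖ θ]
  simp only [h1]
  rw [intervalIntegral.integral_comp_add_right (fun θ ↦ G (circleMap 0 ‖w‖ θ)), zero_add,
    add_comm (2 * π), hper.intervalIntegral_add_eq _ 0, zero_add, circleAverage, smul_smul,
    mul_inv_cancel₀ (by positivity), one_smul]

open Real in
theorem integral_eq_integral_circleAverage {E : Type*} [NormedAddCommGroup E] [NormedSpace ℝ E]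
    [CompleteSpace E] {G : ℂ → E} (hG : Integrable G) :
    ∫ w, G w = ∫ w : ℂ, circleAverage G 0 ‖w‖ := by
  set μ : Measure ℝ := volume.restrict (Ioc 0 (2 * π)) with hμ
  have hmp : MeasurePreserving (fun p : ℝ × ℂ ↦ (p.1, (Circle.exp p.1 : ℂ) * p.2))
      (μ.prod volume) (μ.prod volume) := by
    refine (MeasurePreserving.id μ).skew_product (g := fun θ w ↦ (Circle.exp θ : ℂ) * w) ?_ ?_
    · have : Continuous (Function.uncurry fun (θ : ℝ) (w : ℂ) ↦ (Circle.exp θ : ℂ) * w) := by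
        unfold Function.uncurry
        fun_prop
      exact this.measurable
    · refine Filter.Eventually.of_forall fun θ ↦ ?_
      exact (rotation (Circle.exp θ)).measurePreserving.map_eq
  have hint : Integrable (Function.uncurry fun (θ : ℝ) (w : ℂ) ↦ G ((Circle.exp θ : ℂ) * w))
      (μ.prod volume) :=
    hmp.integrable_comp_of_integrable (hG.comp_snd μ)
  have hrot : ∀ θ : ℝ, ∫ w, G ((Circle.exp θ : ℂ) * w) = ∫ w, G w := fun θ ↦ by
    simpa using (rotation (Circle.exp θ)).measurePreserving.integral_comp'
      (f := (rotation (Circle.exp θ)).toMeasurableEquiv) G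
  have hswap := integral_integral_swap hint
  simp only [hrot, hμ, ← intervalIntegral.integral_of_le two_pi_pos.le,
    intervalIntegral_circle_smul_eq_circleAverage] at hswap
  rw [intervalIntegral.integral_const, sub_zero, integral_smul] at hswap
  exact smul_right_injective E two_pi_pos.ne' hswap

section RadialKernel

theorem integral_fun_norm_complex (f : ℝ → ℝ) :
    ∫ w : ℂ, f ‖w‖ = 2 * Real.pi * ∫ y in Ioi (0 : ℝ), y * f y := by
  rw [integral_fun_norm_addHaar, Complex.finrank_real_complex, Measure.real, Complex.volume_ball]
  simp [mul_assoc]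

theorem integrable_fun_norm_complex {f : ℝ → ℝ} :
    Integrable (fun w : ℂ ↦ f ‖w‖) ↔ IntegrableOn (fun y ↦ y * f y) (Ioi 0) := by
  rw [integrable_fun_norm_addHaar, Complex.finrank_real_complex]
  simp

/-- The radial profile of the error of an approximate Cauchy kernel. -/
noncomputable def errorKernel (r : ℝ) (w : ℂ) : ℝ := (‖w‖ * (1 + (‖w‖ / r) ^ 2))⁻¹

variable {r : ℝ}

theorem errorKernel_nonneg (r : ℝ) (w : ℂ) : 0 ≤ errorKernel r w := by
  unfold errorKernel
  positivity

theorem mul_errorKernel_profile {y : ℝ} (hy : y ∈ Ioi (0 : ℝ)) :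
    y * (y * (1 + (y / r) ^ 2))⁻¹ = (1 + (r⁻¹ * y) ^ 2)⁻¹ := by
  have : y ≠ 0 := (mem_Ioi.1 hy).ne'
  rw [mul_inv, mul_inv_cancel_left₀ this, div_eq_inv_mul]

theorem integrable_errorKernel (hr : 0 < r) : Integrable (errorKernel r) := by
  refine (integrable_fun_norm_complex (f := fun y ↦ (y * (1 + (y / r) ^ 2))⁻¹)).2 ?_
  rw [integrableOn_congr_fun (fun y hy ↦ mul_errorKernel_profile hy) measurableSet_Ioi,
    integrableOn_Ioi_comp_mul_left_iff (fun y ↦ (1 + y ^ 2)⁻¹) 0 (inv_pos.2 hr)]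
  exact integrable_inv_one_add_sq.integrableOn

theorem integral_errorKernel (hr : 0 < r) : ∫ w, errorKernel r w = Real.pi ^ 2 * r := by
  unfold errorKernel
  rw [integral_fun_norm_complex (fun y ↦ (y * (1 + (y / r) ^ 2))⁻¹),
    setIntegral_congr_fun measurableSet_Ioi (fun y hy ↦ mul_errorKernel_profile hy),
    integral_comp_mul_left_Ioi (fun y ↦ (1 + y ^ 2)⁻¹) 0 (inv_pos.2 hr), mul_zero,
    integral_Ioi_inv_one_add_sq]
  simp
  ring

theorem integrable_indicator_inv (R : ℝ) (z : ℂ) :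
    Integrable ((ball z R).indicator fun ζ ↦ (z - ζ)⁻¹) := by
  have h0 : Integrable fun ζ ↦ (1 + R ^ 2) * errorKernel 1 (z - ζ) :=
    ((integrable_errorKernel one_pos).comp_sub_left z).const_mul _
  refine h0.mono' ?_ (Filter.Eventually.of_forall fun ζ ↦ ?_)
  · exact ((measurable_const.sub measurable_id).inv.indicator
      measurableSet_ball).aestronglyMeasurable
  · by_cases hζ : ζ ∈ ball z R
    · rw [indicator_of_mem hζ, norm_inv]
      rw [mem_ball', dist_eq_norm] at hζ
      simp only [errorKernel, div_one]
      rw [mul_inv, mul_left_comm]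
      refine le_mul_of_one_le_right (by positivity) ?_
      rw [← div_eq_mul_inv, one_le_div (by positivity)]
      gcongr
    · rw [indicator_of_notMem hζ, norm_zero]
      have := errorKernel_nonneg 1 (z - ζ)
      positivity

end RadialKernel

section Mollifier

variable {δ : ℝ}

/-- Up to a constant, the `∂/∂z̄` derivative of the radial mollifier `mollifier δ`. -/
noncomputable def mollifierDbar (δ : ℝ) : ℂ → ℂ := (ball 0 δ).indicator fun w ↦ -w

/-- An unnormalized radial mollifier supported in the disc of radius `δ`. -/
noncomputable def mollifier (δ : ℝ) (z : ℂ) : ℝ := max 0 (δ ^ 2 - ‖z‖ ^ 2)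

theorem measurable_mollifierDbar : Measurable (mollifierDbar δ) :=
  measurable_neg.indicator measurableSet_ball

theorem norm_mollifierDbar_le (w : ℂ) :
    ‖mollifierDbar δ w‖ ≤ (ball (0 : ℂ) δ).indicator (fun _ ↦ δ) w := by
  rw [mollifierDbar, norm_indicator_eq_indicator_norm]
  refine indicator_le_indicator' fun hw ↦ ?_
  simpa using (mem_ball_zero_iff.1 hw).le

theorem norm_mollifierDbar_le_radius (hδ : 0 ≤ δ) (w : ℂ) : ‖mollifierDbar δ w‖ ≤ δ :=
  (norm_mollifierDbar_le w).trans (indicator_le_self' (fun _ _ ↦ hδ) w)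

theorem integrable_const_ball (δ : ℝ) :
    Integrable ((ball (0 : ℂ) δ).indicator fun _ ↦ δ) :=
  (integrable_indicator_iff measurableSet_ball).2
    (integrableOn_const measure_ball_lt_top.ne)

theorem integrable_mollifierDbar : Integrable (mollifierDbar δ) :=
  (integrable_const_ball δ).mono' measurable_mollifierDbar.aestronglyMeasurable
    (Filter.Eventually.of_forall (norm_mollifierDbar_le))

theorem integral_norm_mollifierDbar_le (hδ : 0 ≤ δ) :
    ∫ w, ‖mollifierDbar δ w‖ ≤ Real.pi * δ ^ 3 := by
  refine (integral_mono (integrable_mollifierDbar).norm (integrable_const_ball δ)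
    (norm_mollifierDbar_le)).trans_eq ?_
  rw [integral_indicator measurableSet_ball, setIntegral_const, Measure.real, Complex.volume_ball]
  simp [hδ]
  ring

theorem circleIntegral_neg (f : ℂ → ℂ) (c : ℂ) (R : ℝ) :
    (∮ w in C(c, R), -f w) = -∮ w in C(c, R), f w := by
  simpa using circleIntegral.integral_const_mul (-1) f c R

theorem circleAverage_mul_mollifierDbar {F : ℂ → ℂ} {ρ : ℝ} (hρ : 0 < ρ) (hρδ : ρ < δ) :
    Real.circleAverage (fun w ↦ F w * mollifierDbar δ w) 0 ρ =
      -((2 * Real.pi * Complex.I)⁻¹ * ∮ w in C(0, ρ), F w) := by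
  rw [Real.circleAverage_eq_circleIntegral hρ.ne', smul_eq_mul, ← mul_neg,
    ← circleIntegral_neg]
  congr 1
  refine circleIntegral.integral_congr hρ.le fun w hw ↦ ?_
  have hw' : ‖w‖ = ρ := by simpa using hw
  have hw0 : w ≠ 0 := norm_pos_iff.1 (hw' ▸ hρ)
  have hwδ : w ∈ ball 0 δ := by simpa [hw'] using hρδ
  simp only [mollifierDbar, indicator_of_mem hwδ, sub_zero, smul_eq_mul]
  field_simp

theorem circleAverage_mul_mollifierDbar_of_le {F : ℂ → ℂ} {ρ : ℝ} (hρ : 0 ≤ ρ) (hρδ : δ ≤ ρ) :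
    Real.circleAverage (fun w ↦ F w * mollifierDbar δ w) 0 ρ = 0 := by
  rw [Real.circleAverage_congr_sphere (f₂ := fun _ ↦ 0)]
  · exact Real.circleAverage_const 0 0 ρ
  · intro w hw
    have hw' : ‖w‖ = ρ := by simpa [abs_of_nonneg hρ] using hw
    have hwδ : w ∉ ball 0 δ := by simpa [hw'] using hρδ
    simp [mollifierDbar, indicator_of_notMem hwδ]

theorem ae_norm_ne (c : ℝ) : ∀ᵐ w : ℂ, ‖w‖ ≠ c := by
  refine measure_mono_null (fun w hw ↦ ?_) (Measure.addHaar_sphere volume (0 : ℂ) c)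
  simpa using hw

/-- Convolution with `mollifierDbar` kills functions holomorphic on the disc of radius `δ`. -/
theorem integral_mul_mollifierDbar_eq_zero {F : ℂ → ℂ} (hF : Continuous F)
    (hFd : DifferentiableOn ℂ F (ball 0 δ)) : ∫ w, F w * mollifierDbar δ w = 0 := by
  have hint : Integrable fun w ↦ F w * mollifierDbar δ w := by
    have h1 : Integrable ((ball 0 δ).indicator fun w ↦ F w * -w) := by
      refine (integrable_indicator_iff measurableSet_ball).2 ?_
      exact ((by fun_prop : Continuous fun w ↦ F w * -w).continuousOn.integrableOn_compact
        (isCompact_closedBall 0 δ)).mono_set ball_subset_closedBall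
    convert h1 using 1
    ext w
    by_cases hw : w ∈ ball 0 δ <;> simp [mollifierDbar, hw]
  rw [integral_eq_integral_circleAverage hint]
  refine integral_eq_zero_of_ae ?_
  filter_upwards [ae_norm_ne 0] with w hw
  have hw0 : 0 < ‖w‖ := lt_of_le_of_ne (norm_nonneg _) hw.symm
  rcases lt_or_ge ‖w‖ δ with h | h
  · rw [circleAverage_mul_mollifierDbar hw0 h, DiffContOnCl.circleIntegral_eq_zero hw0.le]
    · simp
    · exact (hFd.mono (closure_ball_subset_closedBall.trans
        (closedBall_subset_ball h))).diffContOnCl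
  · simpa using circleAverage_mul_mollifierDbar_of_le hw0.le h

theorem integrable_inv_mul_mollifierDbar (hδ : 0 ≤ δ) (z : ℂ) :
    Integrable fun w ↦ (z - w)⁻¹ * mollifierDbar δ w := by
  have h1 : Integrable fun w ↦ (ball z (‖z‖ + δ)).indicator (fun ζ ↦ (z - ζ)⁻¹) w *
      mollifierDbar δ w :=
    (integrable_indicator_inv _ z).mul_bdd (c := δ) measurable_mollifierDbar.aestronglyMeasurable
      (Filter.Eventually.of_forall (norm_mollifierDbar_le_radius hδ))
  convert h1 using 2 with w
  by_cases hw : w ∈ ball 0 δ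
  · have : w ∈ ball z (‖z‖ + δ) := by
      rw [mem_ball', dist_eq_norm]
      rw [mem_ball_zero_iff] at hw
      linarith [norm_sub_le z w]
    rw [indicator_of_mem this]
  · simp [mollifierDbar, hw]

theorem integral_inv_mul_mollifierDbar (hδ : 0 ≤ δ) (z : ℂ) :
    ∫ w, (z - w)⁻¹ * mollifierDbar δ w = Real.pi * mollifier δ z := by
  rw [integral_eq_integral_circleAverage (integrable_inv_mul_mollifierDbar hδ z)]
  have hae : (fun w : ℂ ↦ Real.circleAverage (fun w ↦ (z - w)⁻¹ * mollifierDbar δ w) 0 ‖w‖)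
      =ᵐ[volume] (ball 0 δ \ closedBall 0 ‖z‖).indicator fun _ ↦ 1 := by
    filter_upwards [ae_norm_ne 0, ae_norm_ne ‖z‖] with w hw hwz
    have hw0 : 0 < ‖w‖ := lt_of_le_of_ne (norm_nonneg _) hw.symm
    rcases lt_or_ge ‖w‖ δ with h | h
    · have hneg : (fun u : ℂ ↦ (z - u)⁻¹) = fun u ↦ -(u - z)⁻¹ := by
        ext u
        rw [← inv_neg, neg_sub]
      rw [circleAverage_mul_mollifierDbar hw0 h, hneg]
      rcases lt_or_gt_of_ne hwz with h' | h'
      · rw [indicator_of_notMem (by simp [h'.le]), DiffContOnCl.circleIntegral_eq_zero hw0.le]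
        · simp
        · refine DifferentiableOn.diffContOnCl fun u hu ↦ ?_
          have hu' : ‖u‖ ≤ ‖w‖ := by simpa using closure_ball_subset_closedBall hu
          have : u - z ≠ 0 := sub_ne_zero.2 fun huz ↦ by
            rw [huz] at hu'
            linarith
          exact ((differentiableAt_id.sub_const z).inv this).neg.differentiableWithinAt
      · rw [indicator_of_mem (by simp [h, h']), circleIntegral_neg,
          circleIntegral.integral_sub_inv_of_mem_ball (by simpa using h')]
        have : (2 * Real.pi * Complex.I : ℂ) ≠ 0 := by simp [Real.pi_ne_zero]
        rw [mul_neg, neg_neg, inv_mul_cancel₀ this]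
    · rw [circleAverage_mul_mollifierDbar_of_le hw0.le h, indicator_of_notMem (by simp [h])]
  rw [integral_congr_ae hae, integral_indicator (measurableSet_ball.diff measurableSet_closedBall),
    setIntegral_const, mollifier]
  rcases lt_or_ge ‖z‖ δ with h | h
  · rw [measureReal_sdiff (closedBall_subset_ball h) measurableSet_closedBall, Measure.real,
      Measure.real, Complex.volume_ball, Complex.volume_closedBall, max_eq_right]
    · simp [hδ]
      ring
    · have := norm_nonneg z
      nlinarith
  · rw [sdiff_eq_bot_iff.2 (ball_subset_closedBall.trans (closedBall_subset_closedBall h)),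
      max_eq_left]
    · simp
    · nlinarith

theorem continuous_mollifier : Continuous (mollifier δ) := by
  unfold mollifier
  fun_prop

theorem mollifier_nonneg (δ : ℝ) (z : ℂ) : 0 ≤ mollifier δ z := le_max_left _ _

theorem mollifier_eq_zero {z : ℂ} (hδ : 0 ≤ δ) (hz : δ ≤ ‖z‖) : mollifier δ z = 0 :=
  max_eq_left (by nlinarith)

theorem integrable_mollifier (hδ : 0 ≤ δ) : Integrable (mollifier δ) := by
  refine continuous_mollifier.integrable_of_hasCompactSupport ?_
  refine HasCompactSupport.intro (isCompact_closedBall (0 : ℂ) δ) fun z hz ↦ ?_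
  refine mollifier_eq_zero hδ ?_
  simpa using (not_le.1 fun h ↦ hz (by simpa using h)).le

theorem integral_mollifier (hδ : 0 ≤ δ) : ∫ z, mollifier δ z = Real.pi * δ ^ 4 / 2 := by
  unfold mollifier
  rw [integral_fun_norm_complex (fun y ↦ max 0 (δ ^ 2 - y ^ 2))]
  have h1 : ∫ y in Ioi (0 : ℝ), y * max 0 (δ ^ 2 - y ^ 2) =
      ∫ y in (0 : ℝ)..δ, (δ ^ 2 * y - y ^ 3) := by
    rw [intervalIntegral.integral_of_le hδ, ← integral_indicator measurableSet_Ioi,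
      ← integral_indicator measurableSet_Ioc]
    congr 1
    ext y
    by_cases hy : 0 < y
    · rcases le_or_gt y δ with h | h
      · rw [indicator_of_mem (by simpa using hy), indicator_of_mem (by simp [hy, h]),
          max_eq_right (by nlinarith)]
        ring
      · rw [indicator_of_mem (by simpa using hy), indicator_of_notMem (by simp [h]),
          max_eq_left (by nlinarith), mul_zero]
    · rw [indicator_of_notMem (by simpa using hy), indicator_of_notMem (by simp [hy])]
  rw [h1, intervalIntegral.integral_sub (by apply Continuous.intervalIntegrable; fun_prop)
    (by apply Continuous.intervalIntegrable; fun_prop), intervalIntegral.integral_const_mul,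
    integral_id, integral_pow]
  ring

end Mollifier

section DbarConv

variable {f ψ : ℂ → ℂ} {δ ω : ℝ}

/-- Up to a constant, the `∂/∂z̄` derivative of the convolution of `f` with `mollifier δ`. -/
noncomputable def dbarConv (δ : ℝ) (f : ℂ → ℂ) (ζ : ℂ) : ℂ := ∫ v, f v * mollifierDbar δ (ζ - v)

theorem dbarConv_eq (δ : ℝ) (f : ℂ → ℂ) (ζ : ℂ) :
    dbarConv δ f ζ = ∫ w, f (ζ - w) * mollifierDbar δ w := by
  rw [dbarConv, ← integral_sub_left_eq_self _ volume ζ]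
  simp

theorem norm_dbarConv_le (hf : Continuous f) (hfs : HasCompactSupport f) (hδ : 0 ≤ δ)
    (h : ∀ u v, ‖u - v‖ < δ → ‖f u - f v‖ ≤ ω) (hω : 0 ≤ ω) (ζ : ℂ) :
    ‖dbarConv δ f ζ‖ ≤ ω * (Real.pi * δ ^ 3) := by
  obtain ⟨C, hC⟩ := hfs.exists_bound_of_continuous hf
  have hD := integrable_mollifierDbar (δ := δ)
  have h0 : ∫ w, f ζ * mollifierDbar δ w = 0 :=
    integral_mul_mollifierDbar_eq_zero continuous_const (differentiableOn_const _)
  have h1 : dbarConv δ f ζ = ∫ w, (f (ζ - w) - f ζ) * mollifierDbar δ w := by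
    simp_rw [sub_mul]
    rw [integral_sub _ (hD.const_mul _), h0, sub_zero, dbarConv_eq]
    exact hD.bdd_mul (c := C) (by fun_prop : Continuous fun w ↦ f (ζ - w)).aestronglyMeasurable
      (Filter.Eventually.of_forall fun w ↦ hC _)
  rw [h1]
  refine (norm_integral_le_of_norm_le (hD.norm.const_mul ω)
    (Filter.Eventually.of_forall fun w ↦ ?_)).trans ?_
  · by_cases hw : w ∈ ball 0 δ
    · rw [norm_mul]
      refine mul_le_mul_of_nonneg_right (h _ _ ?_) (norm_nonneg _)
      simpa using hw
    · simp [mollifierDbar, hw]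
  · rw [integral_const_mul]
    exact mul_le_mul_of_nonneg_left (integral_norm_mollifierDbar_le hδ) hω

theorem dbarConv_eq_zero (hf : Continuous f) {ζ : ℂ} (h : DifferentiableOn ℂ f (ball ζ δ)) :
    dbarConv δ f ζ = 0 := by
  rw [dbarConv_eq]
  refine integral_mul_mollifierDbar_eq_zero (by fun_prop) ?_
  refine h.comp (differentiable_id.const_sub ζ).differentiableOn fun w hw ↦ ?_
  simpa using hw

theorem continuous_dbarConv (hf : Continuous f) (hfs : HasCompactSupport f) :
    Continuous (dbarConv δ f) := by
  obtain ⟨C, hC⟩ := hfs.exists_bound_of_continuous hf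
  rw [funext (dbarConv_eq δ f)]
  refine continuous_of_dominated (bound := fun w ↦ C * ‖mollifierDbar δ w‖) (fun ζ ↦ ?_)
    (fun ζ ↦ Filter.Eventually.of_forall fun w ↦ ?_) (integrable_mollifierDbar.norm.const_mul C)
    (Filter.Eventually.of_forall fun w ↦ by fun_prop)
  · exact (by fun_prop : Continuous fun w ↦ f (ζ - w)).aestronglyMeasurable.mul
      measurable_mollifierDbar.aestronglyMeasurable
  · rw [norm_mul]
    exact mul_le_mul_of_nonneg_right (hC _) (norm_nonneg _)

theorem hasCompactSupport_dbarConv (hf : Continuous f) (hfs : HasCompactSupport f) :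
    HasCompactSupport (dbarConv δ f) := by
  refine HasCompactSupport.intro (hfs.isCompact.cthickening (r := δ)) fun ζ hζ ↦ ?_
  refine dbarConv_eq_zero hf fun w hw ↦ DifferentiableAt.differentiableWithinAt ?_
  have hw' : w ∉ tsupport f := fun hwf ↦
    hζ (mem_cthickening_of_dist_le ζ w δ _ hwf (mem_ball'.1 hw).le)
  exact (differentiableAt_const (0 : ℂ)).congr_of_eventuallyEq
    (notMem_tsupport_iff_eventuallyEq.1 hw')

theorem integrable_mul_inv (hψ : Continuous ψ) (hψs : HasCompactSupport ψ) (z : ℂ) :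
    Integrable fun ζ ↦ ψ ζ * (z - ζ)⁻¹ := by
  obtain ⟨C, hC⟩ := hψs.exists_bound_of_continuous hψ
  obtain ⟨R, hR⟩ := hψs.isCompact.isBounded.subset_ball z
  convert (integrable_indicator_inv R z).bdd_mul hψ.aestronglyMeasurable
    (Filter.Eventually.of_forall hC) using 2 with ζ
  by_cases h : ζ ∈ ball z R
  · rw [indicator_of_mem h]
  · rw [image_eq_zero_of_notMem_tsupport fun h' ↦ h (hR h'), zero_mul, zero_mul]

theorem integral_dbarConv_mul_inv (hδ : 0 ≤ δ) (hf : Continuous f) (hfs : HasCompactSupport f)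
    (z : ℂ) :
    ∫ ζ, dbarConv δ f ζ * (z - ζ)⁻¹ = Real.pi * ∫ v, f v * mollifier δ (z - v) := by
  obtain ⟨R, hR⟩ := (hfs.isCompact.cthickening (r := δ)).isBounded.subset_ball z
  have hint : Integrable (fun p : ℂ × ℂ ↦ f p.2 * mollifierDbar δ (p.1 - p.2) * (z - p.1)⁻¹)
      (volume.prod volume) := by
    have h1 := ((integrable_indicator_inv R z).mul_prod
      (hf.integrable_of_hasCompactSupport hfs (μ := volume))).bdd_mul (c := δ)
      (f := fun p : ℂ × ℂ ↦ mollifierDbar δ (p.1 - p.2))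
      (measurable_mollifierDbar.comp measurable_sub).aestronglyMeasurable
      (Filter.Eventually.of_forall fun p ↦ norm_mollifierDbar_le_radius hδ _)
    convert h1 using 2 with p
    by_cases hp : p.1 ∈ ball z R
    · rw [indicator_of_mem hp]
      ring
    · by_cases hp2 : p.2 ∈ tsupport f
      · have : p.1 - p.2 ∉ ball 0 δ := fun h ↦ hp (hR (mem_cthickening_of_dist_le p.1 p.2 δ _ hp2
          (by simpa [dist_eq_norm] using (mem_ball_zero_iff.1 h).le)))
        simp [mollifierDbar, this]
      · simp [image_eq_zero_of_notMem_tsupport hp2]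
  calc ∫ ζ, dbarConv δ f ζ * (z - ζ)⁻¹
      = ∫ ζ, ∫ v, f v * mollifierDbar δ (ζ - v) * (z - ζ)⁻¹ := by
        simp_rw [integral_mul_const, dbarConv]
    _ = ∫ v, ∫ ζ, f v * mollifierDbar δ (ζ - v) * (z - ζ)⁻¹ := integral_integral_swap hint
    _ = ∫ v, Real.pi * (f v * mollifier δ (z - v)) := by
        congr 1 with v
        rw [← integral_add_right_eq_self _ v]
        simp_rw [add_sub_cancel_right, mul_assoc]
        rw [integral_const_mul]
        have : ∀ w, mollifierDbar δ w * (z - (w + v))⁻¹ =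
            (z - v - w)⁻¹ * mollifierDbar δ w := fun w ↦ by
          rw [mul_comm, sub_sub, add_comm w v]
        simp_rw [this]
        rw [integral_inv_mul_mollifierDbar hδ]
        ring
    _ = _ := integral_const_mul _ _

theorem norm_integral_mul_mollifier_sub_le (hδ : 0 ≤ δ) (hf : Continuous f)
    (hfs : HasCompactSupport f) (h : ∀ u v, ‖u - v‖ < δ → ‖f u - f v‖ ≤ ω) (z : ℂ) :
    ‖(∫ v, f v * mollifier δ (z - v)) - (Real.pi * δ ^ 4 / 2 : ℝ) * f z‖ ≤
      ω * (Real.pi * δ ^ 4 / 2) := by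
  obtain ⟨C, hC⟩ := hfs.exists_bound_of_continuous hf
  have hM : Integrable fun w ↦ (mollifier δ w : ℂ) := (integrable_mollifier hδ).ofReal
  have h0 : ∫ v, f v * mollifier δ (z - v) = ∫ w, f (z - w) * mollifier δ w := by
    rw [← integral_sub_left_eq_self _ volume z]
    simp
  have h1 : ((Real.pi * δ ^ 4 / 2 : ℝ) : ℂ) * f z = ∫ w, f z * mollifier δ w := by
    rw [integral_const_mul, integral_complex_ofReal, integral_mollifier hδ, mul_comm]
  rw [h0, h1, ← integral_sub _ (hM.const_mul _)]
  · refine (norm_integral_le_of_norm_le ((integrable_mollifier hδ).const_mul ω)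
      (Filter.Eventually.of_forall fun w ↦ ?_)).trans_eq ?_
    · rw [← sub_mul, norm_mul, Complex.norm_real, Real.norm_of_nonneg (mollifier_nonneg _ _)]
      rcases lt_or_ge ‖w‖ δ with hw | hw
      · exact mul_le_mul_of_nonneg_right (h _ _ (by simpa using hw)) (mollifier_nonneg _ _)
      · simp [mollifier_eq_zero hδ hw]
    · rw [integral_const_mul, integral_mollifier hδ]
  · exact hM.bdd_mul (c := C) (by fun_prop : Continuous fun w ↦ f (z - w)).aestronglyMeasurable
      (Filter.Eventually.of_forall fun w ↦ hC _)

end DbarConv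

section CauchyTransform

variable {K : Set ℂ} {f ψ : ℂ → ℂ} {r δ ω : ℝ}

theorem integrable_norm_mul_errorKernel (hr : 0 < r) (hψ : Continuous ψ)
    (hψs : HasCompactSupport ψ) (z : ℂ) :
    Integrable fun ζ ↦ ‖ψ ζ‖ * (10 ^ 8 * errorKernel r (z - ζ)) := by
  obtain ⟨C, hC⟩ := hψs.exists_bound_of_continuous hψ
  exact (((integrable_errorKernel hr).comp_sub_left z).const_mul _).bdd_mul (c := C)
    hψ.norm.aestronglyMeasurable (Filter.Eventually.of_forall fun ζ ↦ by simpa using hC ζ)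

theorem exists_approx_setIntegral_of_ball (hK : IsCompact K) (hKc : IsPreconnected Kᶜ)
    (hr : 0 < r) (hψ : Continuous ψ) (hψs : HasCompactSupport ψ) {x : ℂ} (hx : x ∉ K)
    {T : Set ℂ} (hT : MeasurableSet T) (hTx : T ⊆ ball x r) :
    ∃ G, PolyApprox K G ∧ ∀ z ∈ K, ‖G z - ∫ ζ in T, ψ ζ * (z - ζ)⁻¹‖ ≤
      ∫ ζ in T, ‖ψ ζ‖ * (10 ^ 8 * errorKernel r (z - ζ)) := by
  obtain ⟨m, g, hg, hgb⟩ := exists_approx_cauchy_kernel hK hKc hx hr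
  have hi1 : Integrable ψ := hψ.integrable_of_hasCompactSupport hψs
  have hi2 : Integrable fun ζ ↦ (ζ - m) * ψ ζ :=
    (by fun_prop : Continuous fun ζ ↦ (ζ - m) * ψ ζ).integrable_of_hasCompactSupport hψs.mul_left
  refine ⟨fun z ↦ (∫ ζ in T, ψ ζ) * g z + (∫ ζ in T, (ζ - m) * ψ ζ) * g z ^ 2,
    (hg.const_mul hK _).add ((hg.pow hK 2).const_mul hK _), fun z hz ↦ ?_⟩
  have h1 := (hi1.integrableOn (s := T)).mul_const (g z)
  have h2 := (hi2.integrableOn (s := T)).mul_const (g z ^ 2)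
  beta_reduce
  rw [← integral_mul_const, ← integral_mul_const, ← integral_add h1 h2,
    ← integral_sub (f := fun ζ ↦ ψ ζ * g z + (ζ - m) * ψ ζ * g z ^ 2) (h1.add h2)
      (integrable_mul_inv hψ hψs z).integrableOn]
  refine norm_integral_le_of_norm_le (integrable_norm_mul_errorKernel hr hψ hψs z).integrableOn ?_
  have hne : ∀ᵐ ζ ∂volume.restrict T, ζ ≠ z :=
    ae_restrict_of_ae (measure_eq_zero_iff_ae_notMem.1 (measure_singleton z))
  filter_upwards [ae_restrict_mem hT, hne] with ζ hζ hζz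
  have : ψ ζ * g z + (ζ - m) * ψ ζ * g z ^ 2 - ψ ζ * (z - ζ)⁻¹ =
    ψ ζ * (g z + (ζ - m) * g z ^ 2 - (z - ζ)⁻¹) := by ring
  rw [this, norm_mul]
  exact mul_le_mul_of_nonneg_left (hgb z hz ζ (hTx hζ) hζz.symm) (norm_nonneg _)

/-- The Cauchy transform of `ψ` is approximable on `K` when every point of the support of `ψ` is
within `r` of the complement of `K`. -/
theorem exists_approx_cauchyTransform (hK : IsCompact K) (hKc : IsPreconnected Kᶜ)
    (hr : 0 < r) (hψ : Continuous ψ) (hψs : HasCompactSupport ψ)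
    (hnear : ∀ ζ ∈ tsupport ψ, ∃ x ∉ K, ζ ∈ ball x r) :
    ∃ G, PolyApprox K G ∧ ∀ z ∈ K, ‖G z - ∫ ζ, ψ ζ * (z - ζ)⁻¹‖ ≤
      ∫ ζ, ‖ψ ζ‖ * (10 ^ 8 * errorKernel r (z - ζ)) := by
  obtain ⟨S, hsub, hSm, hS⟩ : ∃ S, tsupport ψ ⊆ S ∧ MeasurableSet S ∧ ∀ T ⊆ S, MeasurableSet T →
      ∃ G, PolyApprox K G ∧ ∀ z ∈ K, ‖G z - ∫ ζ in T, ψ ζ * (z - ζ)⁻¹‖ ≤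
        ∫ ζ in T, ‖ψ ζ‖ * (10 ^ 8 * errorKernel r (z - ζ)) := by
    refine hψs.isCompact.induction_on (p := fun N ↦ ∃ S, N ⊆ S ∧ MeasurableSet S ∧ ∀ T ⊆ S,
      MeasurableSet T → ∃ G, PolyApprox K G ∧ ∀ z ∈ K, ‖G z - ∫ ζ in T, ψ ζ * (z - ζ)⁻¹‖ ≤
        ∫ ζ in T, ‖ψ ζ‖ * (10 ^ 8 * errorKernel r (z - ζ))) ?_ ?_ ?_ ?_
    · refine ⟨∅, Subset.rfl, MeasurableSet.empty, fun T hT _ ↦ ⟨fun _ ↦ 0, .const 0, fun z _ ↦ ?_⟩⟩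
      simp [subset_empty_iff.1 hT]
    · rintro s t hst ⟨S, htS, h⟩
      exact ⟨S, hst.trans htS, h⟩
    · rintro s t ⟨S₁, hs, hm₁, h₁⟩ ⟨S₂, ht, hm₂, h₂⟩
      refine ⟨S₁ ∪ S₂, union_subset_union hs ht, hm₁.union hm₂, fun T hT hTm ↦ ?_⟩
      obtain ⟨G₁, hG₁, hb₁⟩ := h₁ (T ∩ S₁) inter_subset_right (hTm.inter hm₁)
      obtain ⟨G₂, hG₂, hb₂⟩ := h₂ (T \ S₁) (fun ζ hζ ↦ (hT hζ.1).resolve_left hζ.2)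
        (hTm.diff hm₁)
      refine ⟨_, hG₁.add hG₂, fun z hz ↦ ?_⟩
      rw [← integral_inter_add_sdiff hm₁ (integrable_mul_inv hψ hψs z).integrableOn,
        ← integral_inter_add_sdiff hm₁
          (integrable_norm_mul_errorKernel hr hψ hψs z).integrableOn, add_sub_add_comm]
      exact (norm_add_le _ _).trans (add_le_add (hb₁ z hz) (hb₂ z hz))
    · intro ζ hζ
      obtain ⟨x, hx, hζx⟩ := hnear ζ hζ
      exact ⟨ball x r, mem_nhdsWithin_of_mem_nhds (isOpen_ball.mem_nhds hζx), ball x r,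
        Subset.rfl, measurableSet_ball, fun T hT hTm ↦
          exists_approx_setIntegral_of_ball hK hKc hr hψ hψs hx hTm hT⟩
  obtain ⟨G, hG, hb⟩ := hS _ hsub (isClosed_tsupport ψ).measurableSet
  refine ⟨G, hG, fun z hz ↦ ?_⟩
  have h0 : ∀ ζ ∉ tsupport ψ, ψ ζ = 0 := fun ζ ↦ image_eq_zero_of_notMem_tsupport
  have h := hb z hz
  rwa [setIntegral_eq_integral_of_forall_compl_eq_zero (fun ζ hζ ↦ by rw [h0 ζ hζ, zero_mul]),
    setIntegral_eq_integral_of_forall_compl_eq_zero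
      (fun ζ hζ ↦ by rw [h0 ζ hζ, norm_zero, zero_mul])] at h

theorem exists_mem_ball_of_mem_tsupport_dbarConv (hf : Continuous f)
    (hfd : DifferentiableOn ℂ f (interior K)) (hδ : 0 < δ) {ζ : ℂ}
    (hζ : ζ ∈ tsupport (dbarConv δ f)) : ∃ x ∉ K, ζ ∈ ball x (3 * δ) := by
  obtain ⟨ζ', hζ', hd⟩ := Metric.mem_closure_iff.1 hζ δ hδ
  have hsub : ¬ball ζ' δ ⊆ interior K := fun h ↦ hζ' (dbarConv_eq_zero hf (hfd.mono h))
  obtain ⟨y, hy, hyK⟩ := not_subset.1 hsub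
  rw [← mem_compl_iff, ← closure_compl] at hyK
  obtain ⟨x, hx, hxy⟩ := Metric.mem_closure_iff.1 hyK δ hδ
  refine ⟨x, hx, ?_⟩
  rw [mem_ball] at hy ⊢
  have := dist_triangle4 ζ ζ' y x
  rw [dist_comm ζ' y] at this
  linarith

theorem exists_approx_of_modulus (hK : IsCompact K) (hKc : IsPreconnected Kᶜ) (hf : Continuous f)
    (hfs : HasCompactSupport f) (hfd : DifferentiableOn ℂ f (interior K)) (hδ : 0 < δ)
    (h : ∀ u v, ‖u - v‖ < δ → ‖f u - f v‖ ≤ ω) :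
    ∃ G, PolyApprox K G ∧ ∀ z ∈ K, ‖f z - G z‖ ≤ (1 + 6 * 10 ^ 8 * Real.pi) * ω := by
  have hω : 0 ≤ ω := (norm_nonneg _).trans (h 0 0 (by simpa using hδ))
  have hψ := continuous_dbarConv (δ := δ) hf hfs
  have hψs := hasCompactSupport_dbarConv (δ := δ) hf hfs
  obtain ⟨G, hG, hb⟩ := exists_approx_cauchyTransform hK hKc (by positivity : 0 < 3 * δ) hψ hψs
    fun ζ ↦ exists_mem_ball_of_mem_tsupport_dbarConv hf hfd hδ
  set A : ℝ := Real.pi ^ 2 * δ ^ 4 / 2 with hA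
  have hA0 : 0 < A := by positivity
  refine ⟨fun z ↦ (A : ℂ)⁻¹ * G z, hG.const_mul hK _, fun z hz ↦ ?_⟩
  have h1 : ∫ ζ, ‖dbarConv δ f ζ‖ * (10 ^ 8 * errorKernel (3 * δ) (z - ζ)) ≤
      A * (6 * 10 ^ 8 * Real.pi * ω) := by
    have hE := ((integrable_errorKernel (by positivity : 0 < 3 * δ)).comp_sub_left z).const_mul
      (10 ^ 8)
    refine (integral_mono (integrable_norm_mul_errorKernel (by positivity) hψ hψs z)
      (hE.const_mul (ω * (Real.pi * δ ^ 3))) fun ζ ↦ ?_).trans_eq ?_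
    · exact mul_le_mul_of_nonneg_right (norm_dbarConv_le hf hfs hδ.le h hω ζ)
        (mul_nonneg (by positivity) (errorKernel_nonneg _ _))
    · rw [integral_const_mul, integral_const_mul,
        integral_sub_left_eq_self (errorKernel (3 * δ)) volume z,
        integral_errorKernel (by positivity), hA]
      ring
  have h2 : ‖(∫ ζ, dbarConv δ f ζ * (z - ζ)⁻¹) - A * f z‖ ≤ A * ω := by
    have heq : (∫ ζ, dbarConv δ f ζ * (z - ζ)⁻¹) - A * f z = Real.pi *
        ((∫ v, f v * mollifier δ (z - v)) - (Real.pi * δ ^ 4 / 2 : ℝ) * f z) := by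
      rw [integral_dbarConv_mul_inv hδ.le hf hfs, hA]
      push_cast
      ring
    rw [heq, norm_mul, Complex.norm_real, Real.norm_of_nonneg Real.pi_pos.le]
    refine (mul_le_mul_of_nonneg_left
      (norm_integral_mul_mollifier_sub_le hδ.le hf hfs h z) Real.pi_pos.le).trans_eq ?_
    rw [hA]
    ring
  have h3 : ‖A * f z - G z‖ ≤ A * ((1 + 6 * 10 ^ 8 * Real.pi) * ω) := by
    rw [norm_sub_rev, ← sub_add_sub_cancel]
    refine (norm_add_le _ _).trans ((add_le_add ((hb z hz).trans h1) h2).trans_eq ?_)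
    ring
  have hA0' : (A : ℂ) ≠ 0 := by exact_mod_cast hA0.ne'
  have h4 : f z - (A : ℂ)⁻¹ * G z = (A : ℂ)⁻¹ * (A * f z - G z) := by
    rw [mul_sub, inv_mul_cancel_left₀ hA0']
  rw [h4, norm_mul, norm_inv, Complex.norm_real, Real.norm_of_nonneg hA0.le]
  exact (inv_mul_le_iff₀ hA0).2 h3

theorem polyApprox_of_continuous (hK : IsCompact K) (hKc : IsPreconnected Kᶜ) (hf : Continuous f)
    (hfs : HasCompactSupport f) (hfd : DifferentiableOn ℂ f (interior K)) : PolyApprox K f := by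
  refine .of_forall_exists fun ε hε ↦ ?_
  have hC : (0 : ℝ) < 1 + 6 * 10 ^ 8 * Real.pi := by positivity
  obtain ⟨δ, hδ, h⟩ := Metric.uniformContinuous_iff.1
    (hfs.uniformContinuous_of_continuous hf) (ε / 2 / (1 + 6 * 10 ^ 8 * Real.pi)) (by positivity)
  obtain ⟨G, hG, hb⟩ := exists_approx_of_modulus hK hKc hf hfs hfd hδ
    (ω := ε / 2 / (1 + 6 * 10 ^ 8 * Real.pi)) fun u v huv ↦ by
      simpa [dist_eq_norm] using (h (by simpa [dist_eq_norm] using huv)).le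
  refine ⟨G, hG, fun z hz ↦ (hb z hz).trans_lt ?_⟩
  rw [mul_div_cancel₀ _ hC.ne']
  linarith

theorem exists_continuous_hasCompactSupport_eqOn (hK : IsCompact K) (hf : ContinuousOn f K) :
    ∃ F : ℂ → ℂ, Continuous F ∧ HasCompactSupport F ∧ EqOn F f K := by
  obtain ⟨g, hg⟩ := ContinuousMap.exists_restrict_eq hK.isClosed ⟨K.domRestrict f, hf.domRestrict⟩
  obtain ⟨χ, hχ1, -, hχs, -⟩ := exists_continuous_one_zero_of_isCompact hK isClosed_empty
    (disjoint_empty K)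
  refine ⟨fun z ↦ (χ z : ℂ) * g z, by fun_prop, ?_, fun z hz ↦ ?_⟩
  · exact (hχs.comp_left Complex.ofReal_zero).mul_right
  · have h1 : g z = f z := DFunLike.congr_fun hg ⟨z, hz⟩
    have h2 : χ z = 1 := hχ1 hz
    simp [h1, h2]

end CauchyTransform

/-- **Mergelyan's theorem.** If `K ⊆ ℂ` is compact with connected complement and
`f : K → ℂ` is continuous on `K` and holomorphic in the interior of `K`, then for every
`ε > 0` there is a polynomial `p(z) = ∑_{k=0}^n a_k z^k` with
`sup_{z ∈ K} |f z - p z| < ε`. -/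
theorem mergelyan (K : Set ℂ) (hK : IsCompact K) (hKc : IsConnected Kᶜ)
    (f : ℂ → ℂ) (hfc : ContinuousOn f K) (hfd : DifferentiableOn ℂ f (interior K))
    (ε : ℝ) (hε : 0 < ε) :
    ∃ (n : ℕ) (a : ℕ → ℂ), ∀ z ∈ K,
      ‖f z - ∑ k ∈ Finset.range (n + 1), a k * z ^ k‖ < ε := by
  obtain ⟨F, hF, hFs, hFf⟩ := exists_continuous_hasCompactSupport_eqOn hK hfc
  have hFd := hfd.congr fun z hz ↦ hFf (interior_subset hz)
  obtain ⟨p, hp⟩ := (polyApprox_of_continuous hK hKc.isPreconnected hF hFs hFd).congr hFf ε hε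
  refine ⟨p.natDegree, p.coeff, fun z hz ↦ ?_⟩
  rw [← Polynomial.eval_eq_sum_range]
  exact hp z hz
end

section
/- Extension Lemma: let J be a unit imaginary quaternion, let Ω_J be a domain in the plane ℂ_J that is symmetric with respect to the real axis and satisfies Ω_J ∩ ℝ ≠ ∅, and let U = ⋃_{x+Jy ∈ Ω_J, I ∈ 𝕊} {x + Iy} be its axially symmetric completion in ℍ. If f : Ω_J → ℍ satisfies (1/2)(∂/∂x + J ∂/∂y) f(x+Jy) = 0 on Ω_J, then the function ext(f)(x+Iy) = (1/2)[f(x+Jy) + f(x−Jy)] + I·(1/2)·J·[f(x−Jy) − f(x+Jy)] is the unique slice regular function on U whose restriction to Ω_J equals f. -/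
noncomputable section

/-- The complex plane `ℂ_I = {x + I y : x, y ∈ ℝ}` inside the quaternions, for a
unit imaginary quaternion `I`. -/
def slicePlane (I : Quaternion ℝ) : Set (Quaternion ℝ) :=
  {q | ∃ x y : ℝ, q = (x : Quaternion ℝ) + y • I}

/-- A set `U ⊆ ℍ` is axially symmetric if `x + I y ∈ U` implies `x + J y ∈ U`
for all unit imaginary quaternions `J`. -/
def AxiallySymmetric (U : Set (Quaternion ℝ)) : Prop :=
  ∀ (x y : ℝ) (I J : Quaternion ℝ), I ^ 2 = -1 → J ^ 2 = -1 →
    ((x : Quaternion ℝ) + y • I) ∈ U → ((x : Quaternion ℝ) + y • J) ∈ U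

/-- `f` is slice regular on `U`: it is real differentiable on `U` and for every unit
imaginary quaternion `I` its restriction to `U ∩ ℂ_I` satisfies
`(1/2)(∂/∂x + I ∂/∂y) f(x + I y) = 0`. -/
def SliceRegularOn (f : Quaternion ℝ → Quaternion ℝ) (U : Set (Quaternion ℝ)) : Prop :=
  DifferentiableOn ℝ f U ∧
  ∀ (I : Quaternion ℝ), I ^ 2 = -1 → ∀ x y : ℝ, ((x : Quaternion ℝ) + y • I) ∈ U →
    fderiv ℝ (fun p : ℝ × ℝ => f ((p.1 : Quaternion ℝ) + p.2 • I)) (x, y) (1, 0)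
      + I * fderiv ℝ (fun p : ℝ × ℝ => f ((p.1 : Quaternion ℝ) + p.2 • I)) (x, y) (0, 1) = 0

/-- The slice derivative of `f` at `q`, i.e. `(∂/∂x) f`. -/
def sliceDeriv (f : Quaternion ℝ → Quaternion ℝ) (q : Quaternion ℝ) : Quaternion ℝ :=
  fderiv ℝ f q 1

/-- A quaternion is a (strictly) positive real number. -/
def IsPosReal (q : Quaternion ℝ) : Prop := ∃ r : ℝ, 0 < r ∧ q = (r : Quaternion ℝ)

/-- `f ∈ 𝒩(U)`: `f` is slice regular on `U` and preserves every slice `ℂ_I`. -/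
def QIntrinsicOn (f : Quaternion ℝ → Quaternion ℝ) (U : Set (Quaternion ℝ)) : Prop :=
  SliceRegularOn f U ∧
  ∀ (I : Quaternion ℝ), I ^ 2 = -1 → ∀ q ∈ U ∩ slicePlane I, f q ∈ slicePlane I

/-- The class `𝔯(ℍ)` of axially symmetric open sets whose intersection with every
slice plane `ℂ_I` is simply connected. -/
def MemFrakR (Ω : Set (Quaternion ℝ)) : Prop :=
  IsOpen Ω ∧ AxiallySymmetric Ω ∧
  ∀ I : Quaternion ℝ, I ^ 2 = -1 → SimplyConnectedSpace ↥(Ω ∩ slicePlane I)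

/-- `S` is a Jordan region in the plane `ℂ_I`: a bounded subset of `ℂ_I`, open in `ℂ_I`,
whose boundary (inside `ℂ_I`) is a Jordan curve. -/
def IsJordanRegionIn (I : Quaternion ℝ) (S : Set (Quaternion ℝ)) : Prop :=
  S ⊆ slicePlane I ∧ Bornology.IsBounded S ∧
  IsOpen (Subtype.val ⁻¹' S : Set ↥(slicePlane I)) ∧
  ∃ γ : Circle → ↥(slicePlane I), Continuous γ ∧ Function.Injective γ ∧
    Set.range γ = frontier (Subtype.val ⁻¹' S : Set ↥(slicePlane I))

/-- The axially symmetric completion `⋃_{x+Jy ∈ Ω, I ∈ 𝕊} {x + I y}` of a subset `Ω`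
of the slice plane `ℂ_J`. -/
def axSymmCompletion (J : Quaternion ℝ) (Ω : Set (Quaternion ℝ)) : Set (Quaternion ℝ) :=
  {q | ∃ x y : ℝ, ∃ I : Quaternion ℝ, I ^ 2 = -1 ∧
    ((x : Quaternion ℝ) + y • J) ∈ Ω ∧ q = (x : Quaternion ℝ) + y • I}

/-- The first modulus of continuity `ω₁(f; δ)` of `f` on the set `K`. -/
def omega1 (f : Quaternion ℝ → Quaternion ℝ) (K : Set (Quaternion ℝ)) (δ : ℝ) : ℝ :=
  sSup {r : ℝ | ∃ u ∈ K, ∃ v ∈ K, ‖u - v‖ ≤ δ ∧ r = ‖f u - f v‖}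

open Quaternion Topology Filter Asymptotics

theorem re_eq_zero_of_sq_eq_neg_one {I : Quaternion ℝ} (hI : I ^ 2 = -1) : I.re = 0 := by
  rw [sq] at hI
  have h0 := congrArg QuaternionAlgebra.re hI
  have h1 := congrArg QuaternionAlgebra.imI hI
  have h2 := congrArg QuaternionAlgebra.imJ hI
  have h3 := congrArg QuaternionAlgebra.imK hI
  simp at h0 h1 h2 h3
  by_contra hne
  have e1 : I.imI = 0 := by
    apply mul_left_cancel₀ hne; linarith
  have e2 : I.imJ = 0 := by
    apply mul_left_cancel₀ hne; linarith
  have e3 : I.imK = 0 := by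
    apply mul_left_cancel₀ hne; linarith
  rw [e1, e2, e3] at h0
  nlinarith

theorem norm_eq_one_of_sq_eq_neg_one {I : Quaternion ℝ} (hI : I ^ 2 = -1) : ‖I‖ = 1 := by
  have h : ‖I‖ ^ 2 = 1 := by rw [← norm_pow, hI, norm_neg, norm_one]
  exact (pow_eq_one_iff_of_nonneg (norm_nonneg I) two_ne_zero).mp h

theorem mul_self_of_sq_eq_neg_one {I : Quaternion ℝ} (hI : I ^ 2 = -1) : I * I = -1 := by
  rw [← sq, hI]

theorem eq_zero_of_eq_neg_self {q : Quaternion ℝ} (h : q = -q) : q = 0 := by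
  have h2 : (2 : ℝ) • q = 0 := by rw [two_smul, ← eq_neg_iff_add_eq_zero, ← h]
  exact (smul_eq_zero.mp h2).resolve_left two_ne_zero

/-- The real part as a continuous linear functional on the quaternions. -/
def quatReCLM : Quaternion ℝ →L[ℝ] ℝ :=
  LinearMap.toContinuousLinearMap
    { toFun := fun q => q.re
      map_add' := fun _ _ => rfl
      map_smul' := fun _ _ => rfl }

@[simp] theorem quatReCLM_apply (q : Quaternion ℝ) : quatReCLM q = q.re := rfl

/-- The imaginary part as a continuous linear endomorphism of the quaternions. -/
def quatImCLM : Quaternion ℝ →L[ℝ] Quaternion ℝ :=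
  ContinuousLinearMap.id ℝ (Quaternion ℝ) - quatReCLM.smulRight (1 : Quaternion ℝ)

theorem quatImCLM_apply (q : Quaternion ℝ) : quatImCLM q = q - (q.re : Quaternion ℝ) := by
  simp [quatImCLM, Algebra.smul_def]

/-- The parametrisation `(x, y) ↦ x + I y` of the slice plane `ℂ_I`. -/
def sliceCLM (I : Quaternion ℝ) : ℝ × ℝ →L[ℝ] Quaternion ℝ :=
  (ContinuousLinearMap.fst ℝ ℝ ℝ).smulRight (1 : Quaternion ℝ) +
    (ContinuousLinearMap.snd ℝ ℝ ℝ).smulRight I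

theorem sliceCLM_apply (I : Quaternion ℝ) (p : ℝ × ℝ) :
    sliceCLM I p = (p.1 : Quaternion ℝ) + p.2 • I := by
  simp [sliceCLM, Algebra.smul_def]

theorem re_slice {I : Quaternion ℝ} (hI : I ^ 2 = -1) (x y : ℝ) :
    ((x : Quaternion ℝ) + y • I).re = x := by
  simp [re_eq_zero_of_sq_eq_neg_one hI]

theorem quatImCLM_slice {I : Quaternion ℝ} (hI : I ^ 2 = -1) (x y : ℝ) :
    quatImCLM ((x : Quaternion ℝ) + y • I) = y • I := by
  rw [quatImCLM_apply, re_slice hI, add_sub_cancel_left]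

theorem norm_quatImCLM_le (q : Quaternion ℝ) : ‖quatImCLM q‖ ≤ ‖q‖ := by
  apply le_of_sq_le_sq _ (norm_nonneg q)
  rw [sq, sq, ← Quaternion.normSq_eq_norm_mul_self, ← Quaternion.normSq_eq_norm_mul_self,
    Quaternion.normSq_def', Quaternion.normSq_def', quatImCLM_apply]
  simp
  positivity

theorem abs_re_le_norm (q : Quaternion ℝ) : |q.re| ≤ ‖q‖ := by
  apply abs_le_of_sq_le_sq _ (norm_nonneg q)
  rw [sq ‖q‖, ← Quaternion.normSq_eq_norm_mul_self, Quaternion.normSq_def']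
  nlinarith [sq_nonneg q.imI, sq_nonneg q.imJ, sq_nonneg q.imK]

/-- Left slice holomorphic functions of two real variables vanishing on the real points of a
domain vanish on the whole domain. -/
theorem eq_zero_of_cauchyRiemann_of_real {I : Quaternion ℝ} (hI : I ^ 2 = -1)
    {k : ℝ × ℝ → Quaternion ℝ} {D : Set (ℝ × ℝ)} (hD : IsOpen D) (hDc : IsPreconnected D)
    (hk : ∀ p ∈ D, DifferentiableAt ℝ k p ∧ fderiv ℝ k p (1, 0) + I * fderiv ℝ k p (0, 1) = 0)
    {x₀ : ℝ} (hx₀ : (x₀, (0 : ℝ)) ∈ D) (hreal : ∀ x : ℝ, (x, (0 : ℝ)) ∈ D → k (x, 0) = 0)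
    {p : ℝ × ℝ} (hp : p ∈ D) : k p = 0 := by
  have hII := mul_self_of_sq_eq_neg_one hI
  let a := star (k p)
  let φ : Quaternion ℝ →L[ℝ] ℂ := LinearMap.toContinuousLinearMap
    { toFun := fun q => ⟨(q * a).re, -(I * q * a).re⟩
      map_add' := fun u v => by
        apply Complex.ext
        · simp only [add_mul, Quaternion.re_add, Complex.add_re]
        · simp only [add_mul, mul_add, Quaternion.re_add, Complex.add_im, neg_add]
      map_smul' := fun c v => by
        apply Complex.ext
        · simp only [smul_mul_assoc, Quaternion.re_smul, Complex.smul_re, RingHom.id_apply]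
        · simp only [smul_mul_assoc, mul_smul_comm, Quaternion.re_smul, Complex.smul_im,
            RingHom.id_apply, smul_neg] }
  have hφ : ∀ q, φ q = ⟨(q * a).re, -(I * q * a).re⟩ := fun _ => rfl
  have hφI : ∀ q, φ (I * q) = Complex.I * φ q := fun q => by
    rw [hφ, hφ]
    apply Complex.ext <;> simp [-Quaternion.re_mul, ← mul_assoc, hII]
  let e := Complex.equivRealProdCLM
  have he : ∀ z : ℂ, e z = (z.re, z.im) := fun _ => rfl
  let E : Set ℂ := e ⁻¹' D
  have hE : IsOpen E := hD.preimage e.continuous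
  have hEc : IsPreconnected E := by
    have := hDc.image e.symm e.symm.continuous.continuousOn
    rwa [e.symm.image_eq_preimage_symm] at this
  let G : ℂ → ℂ := fun z => φ (k (e z))
  have hG : DifferentiableOn ℂ G E := by
    intro z hz
    obtain ⟨hd, hcr⟩ := hk (e z) hz
    apply DifferentiableAt.differentiableWithinAt
    have hfd : HasFDerivAt G (φ.comp ((fderiv ℝ k (e z)).comp (e : ℂ →L[ℝ] ℝ × ℝ))) z :=
      φ.hasFDerivAt.comp z (hd.hasFDerivAt.comp z e.hasFDerivAt)
    rw [differentiableAt_complex_iff_differentiableAt_real]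
    refine ⟨hfd.differentiableAt, ?_⟩
    rw [hfd.fderiv]
    have h1 : fderiv ℝ k (e z) (0, 1) = I * fderiv ℝ k (e z) (1, 0) := by
      rw [eq_neg_of_add_eq_zero_left hcr, mul_neg, ← mul_assoc, hII]
      simp
    have e1 : e 1 = (1, 0) := by simp [he]
    have e2 : e Complex.I = (0, 1) := by simp [he]
    simp [e1, e2, h1, hφI]
  have hfreq : ∃ᶠ z in 𝓝[≠] (x₀ : ℂ), G z = 0 := by
    have hx : e (x₀ : ℂ) ∈ D := by simpa [he] using hx₀
    have hcont : Tendsto (fun t : ℝ => (t : ℂ)) (𝓝[≠] x₀) (𝓝[≠] (x₀ : ℂ)) :=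
      (Complex.continuous_ofReal.continuousAt (x := x₀)).continuousWithinAt.tendsto_nhdsWithin
        (fun t ht => by simpa using ht)
    refine hcont.frequently (Eventually.frequently ?_)
    have : ∀ᶠ t : ℝ in 𝓝[≠] x₀, (t : ℂ) ∈ E :=
      (hcont.mono_right nhdsWithin_le_nhds).eventually (hE.mem_nhds hx)
    filter_upwards [this] with t ht
    have ht' : (t, (0 : ℝ)) ∈ D := by simpa [E, he] using ht
    simp [G, he, hreal t ht']
  have hzero := (hG.analyticOnNhd hE).eqOn_zero_of_preconnected_of_frequently_eq_zero hEc
    (z₀ := (x₀ : ℂ)) (by simpa [E, he] using hx₀) hfreq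
  have hpz := hzero (x := e.symm p) (by simpa [E] using hp)
  have hre : (k p * star (k p)).re = 0 := by
    have := congrArg Complex.re hpz
    simpa only [G, e.apply_symm_apply, hφ, Pi.zero_apply, Complex.zero_re] using this
  rwa [← Quaternion.normSq_def, Quaternion.normSq_eq_zero] at hre

/-- The extension `x + I y ↦ α (x, y) + I β (x, y)`, written with `y = |im q|`. -/
def axialExt (α β : ℝ × ℝ → Quaternion ℝ) (q : Quaternion ℝ) : Quaternion ℝ :=
  α (q.re, ‖quatImCLM q‖) + (‖quatImCLM q‖⁻¹ • quatImCLM q) * β (q.re, ‖quatImCLM q‖)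

theorem axialExt_slice {α β : ℝ × ℝ → Quaternion ℝ} (hα : ∀ x y, α (x, -y) = α (x, y))
    (hβ : ∀ x y, β (x, -y) = -β (x, y)) {I : Quaternion ℝ} (hI : I ^ 2 = -1) (x y : ℝ) :
    axialExt α β ((x : Quaternion ℝ) + y • I) = α (x, y) + I * β (x, y) := by
  have hβ0 : β (x, 0) = 0 := by
    have h := hβ x 0
    rw [neg_zero] at h
    exact eq_zero_of_eq_neg_self h
  rw [axialExt, quatImCLM_slice hI, re_slice hI, norm_smul, norm_eq_one_of_sq_eq_neg_one hI,
    mul_one, Real.norm_eq_abs]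
  rcases lt_trichotomy y 0 with hy | rfl | hy
  · rw [abs_of_neg hy, hα, hβ, smul_smul, inv_neg, neg_mul, inv_mul_cancel₀ hy.ne]
    simp
  · simp [hβ0]
  · rw [abs_of_pos hy, smul_smul, inv_mul_cancel₀ hy.ne', one_smul]

theorem differentiableAt_axialExt_of_im_ne_zero {α β : ℝ × ℝ → Quaternion ℝ} {q : Quaternion ℝ}
    (hq : quatImCLM q ≠ 0) (hα : DifferentiableAt ℝ α (q.re, ‖quatImCLM q‖))
    (hβ : DifferentiableAt ℝ β (q.re, ‖quatImCLM q‖)) :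
    DifferentiableAt ℝ (axialExt α β) q := by
  have hn : DifferentiableAt ℝ (fun q : Quaternion ℝ => ‖quatImCLM q‖) q :=
    quatImCLM.differentiableAt.norm ℝ hq
  have hp : DifferentiableAt ℝ (fun q : Quaternion ℝ => (q.re, ‖quatImCLM q‖)) q :=
    quatReCLM.differentiableAt.prodMk hn
  exact (hα.comp q hp).add
    (((hn.inv (norm_ne_zero_iff.mpr hq)).smul quatImCLM.differentiableAt).mul (hβ.comp q hp))

theorem differentiableAt_axialExt_of_real {α β : ℝ × ℝ → Quaternion ℝ}
    (hα : ∀ x y, α (x, -y) = α (x, y)) (hβ : ∀ x y, β (x, -y) = -β (x, y)) {x : ℝ}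
    (hαd : DifferentiableAt ℝ α (x, 0)) (hβd : DifferentiableAt ℝ β (x, 0)) :
    DifferentiableAt ℝ (axialExt α β) (x : Quaternion ℝ) := by
  have hβ0 : ∀ t, β (t, 0) = 0 := fun t => by
    have h := hβ t 0
    rw [neg_zero] at h
    exact eq_zero_of_eq_neg_self h
  have hα2 : fderiv ℝ α (x, 0) (0, 1) = 0 := by
    have h1 : HasDerivAt (fun t : ℝ => α (x, t)) (fderiv ℝ α (x, 0) (0, 1)) 0 :=
      hαd.hasFDerivAt.comp_hasDerivAt (0 : ℝ) ((hasDerivAt_const 0 x).prodMk (hasDerivAt_id 0))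
    have h2 : HasDerivAt (fun t : ℝ => α (x, -t)) (-fderiv ℝ α (x, 0) (0, 1)) 0 := by
      have h1' : HasDerivAt (fun t : ℝ => α (x, t)) (fderiv ℝ α (x, 0) (0, 1)) (-0) := by
        rwa [neg_zero]
      have h := h1'.scomp (0 : ℝ) (hasDerivAt_neg (0 : ℝ))
      rw [neg_one_smul] at h
      exact h
    simp only [hα] at h2
    exact eq_zero_of_eq_neg_self (h1.unique h2)
  have hβ1 : fderiv ℝ β (x, 0) (1, 0) = 0 := by
    have h1 : HasDerivAt (fun t : ℝ => β (t, 0)) (fderiv ℝ β (x, 0) (1, 0)) x :=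
      HasFDerivAt.comp_hasDerivAt x (f := fun t : ℝ => (t, (0 : ℝ))) hβd.hasFDerivAt
        ((hasDerivAt_id x).prodMk (hasDerivAt_const x 0))
    simp only [hβ0] at h1
    exact h1.unique (hasDerivAt_const x 0)
  have hsplit : ∀ (L : ℝ × ℝ →L[ℝ] Quaternion ℝ) (s t : ℝ),
      L (s, t) = s • L (1, 0) + t • L (0, 1) := fun L s t => by
    rw [← map_smul, ← map_smul, ← map_add]; simp
  set a := fderiv ℝ α (x, 0) (1, 0)
  set b := fderiv ℝ β (x, 0) (0, 1)
  have him : quatImCLM (x : Quaternion ℝ) = 0 := by simp [quatImCLM_apply]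
  let P : Quaternion ℝ → ℝ × ℝ := fun q => (q.re, ‖quatImCLM q‖)
  have hPx : P (x : Quaternion ℝ) = (x, 0) := by simp [P, him]
  have hPc : Tendsto P (𝓝 (x : Quaternion ℝ)) (𝓝 (x, 0)) := by
    rw [← hPx]
    exact (quatReCLM.continuous.prodMk quatImCLM.continuous.norm).continuousAt
  have hPO : (fun q => P q - (x, 0)) =O[𝓝 (x : Quaternion ℝ)] fun q => q - (x : Quaternion ℝ) := by
    refine IsBigO.of_bound 1 (Eventually.of_forall fun q => ?_)
    rw [one_mul]
    refine max_le ?_ ?_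
    · simpa [P] using abs_re_le_norm (q - (x : Quaternion ℝ))
    · simpa [P, him] using norm_quatImCLM_le (q - (x : Quaternion ℝ))
  have hαo := (hαd.hasFDerivAt.isLittleO.comp_tendsto hPc).trans_isBigO hPO
  have hβo := (hβd.hasFDerivAt.isLittleO.comp_tendsto hPc).trans_isBigO hPO
  have hβo' : (fun q => (‖quatImCLM q‖⁻¹ • quatImCLM q) *
      (β (P q) - β (x, 0) - fderiv ℝ β (x, 0) (P q - (x, 0))))
      =o[𝓝 (x : Quaternion ℝ)] fun q => q - (x : Quaternion ℝ) := by
    refine IsBigO.trans_isLittleO (IsBigO.of_bound 1 (Eventually.of_forall fun q => ?_)) hβo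
    rw [norm_mul]
    refine mul_le_mul_of_nonneg_right ?_ (norm_nonneg _)
    rw [norm_smul, norm_inv, norm_norm]
    exact inv_mul_le_one
  refine HasFDerivAt.differentiableAt
    (f' := quatReCLM.smulRight a + ((ContinuousLinearMap.mul ℝ (Quaternion ℝ)).flip b).comp quatImCLM)
    (HasFDerivAt.of_isLittleO ((hαo.add hβo').congr_left fun q => ?_))
  have hcancel : (‖quatImCLM q‖⁻¹ • quatImCLM q) * (‖quatImCLM q‖ • b) = quatImCLM q * b := by
    rcases eq_or_ne (quatImCLM q) 0 with h | h
    · simp [h]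
    · rw [smul_mul_smul_comm, inv_mul_cancel₀ (norm_ne_zero_iff.mpr h), one_smul]
  have hA : fderiv ℝ α (x, 0) (q.re - x, ‖quatImCLM q‖) = (q.re - x) • a := by
    rw [hsplit, hα2, smul_zero, add_zero]
  have hB : fderiv ℝ β (x, 0) (q.re - x, ‖quatImCLM q‖) = ‖quatImCLM q‖ • b := by
    rw [hsplit, hβ1, smul_zero, zero_add]
  have hI : quatImCLM (q - (x : Quaternion ℝ)) = quatImCLM q := by rw [map_sub, him, sub_zero]
  simp only [Function.comp_apply, axialExt, P, Prod.mk_sub_mk, sub_zero, hβ0, him, norm_zero,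
    hA, hB, hI, mul_sub, hcancel, Quaternion.re_coe, mul_zero, add_zero,
    add_apply, ContinuousLinearMap.smulRight_apply,
    ContinuousLinearMap.comp_apply, ContinuousLinearMap.flip_apply,
    ContinuousLinearMap.mul_apply', quatReCLM_apply, Quaternion.re_sub]
  abel

/-- **Extension Lemma.** Let `J² = -1`, let `Ω` be a domain in the plane `ℂ_J` symmetric
with respect to the real axis and meeting `ℝ`, and let `U` be its axially symmetric
completion. If `f : Ω → ℍ` satisfies `(1/2)(∂/∂x + J ∂/∂y) f = 0` on `Ω`, then the
function given by
`ext(f)(x+Iy) = (1/2)[f(x+Jy) + f(x−Jy)] + I (1/2) J [f(x−Jy) − f(x+Jy)]`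
is the unique slice regular function on `U` whose restriction to `Ω` equals `f`. -/
theorem extension_lemma
    (J : Quaternion ℝ) (hJ : J ^ 2 = -1)
    (Ω : Set (Quaternion ℝ)) (hΩsub : Ω ⊆ slicePlane J)
    (hΩopen : IsOpen (Subtype.val ⁻¹' Ω : Set ↥(slicePlane J)))
    (hΩconn : IsConnected Ω)
    (hΩsymm : ∀ x y : ℝ, ((x : Quaternion ℝ) + y • J) ∈ Ω →
      ((x : Quaternion ℝ) - y • J) ∈ Ω)
    (hΩreal : ∃ x : ℝ, (x : Quaternion ℝ) ∈ Ω)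
    (f : Quaternion ℝ → Quaternion ℝ)
    (hf : ∀ x y : ℝ, ((x : Quaternion ℝ) + y • J) ∈ Ω →
      DifferentiableAt ℝ (fun p : ℝ × ℝ => f ((p.1 : Quaternion ℝ) + p.2 • J)) (x, y) ∧
      fderiv ℝ (fun p : ℝ × ℝ => f ((p.1 : Quaternion ℝ) + p.2 • J)) (x, y) (1, 0)
        + J * fderiv ℝ (fun p : ℝ × ℝ => f ((p.1 : Quaternion ℝ) + p.2 • J)) (x, y) (0, 1)
        = 0) :
    ∃ g : Quaternion ℝ → Quaternion ℝ,
      (∀ (I : Quaternion ℝ), I ^ 2 = -1 → ∀ x y : ℝ, ((x : Quaternion ℝ) + y • J) ∈ Ω →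
        g ((x : Quaternion ℝ) + y • I)
          = (1 / 2 : ℝ) • (f ((x : Quaternion ℝ) + y • J) + f ((x : Quaternion ℝ) - y • J))
            + I * ((1 / 2 : ℝ) •
                (J * (f ((x : Quaternion ℝ) - y • J) - f ((x : Quaternion ℝ) + y • J))))) ∧
      SliceRegularOn g (axSymmCompletion J Ω) ∧ Set.EqOn g f Ω ∧
      ∀ h : Quaternion ℝ → Quaternion ℝ,
        SliceRegularOn h (axSymmCompletion J Ω) → Set.EqOn h f Ω →
        Set.EqOn h g (axSymmCompletion J Ω) := by
  have hJre := re_eq_zero_of_sq_eq_neg_one hJ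
  have hJJ := mul_self_of_sq_eq_neg_one hJ
  let D : Set (ℝ × ℝ) := {p | ((p.1 : Quaternion ℝ) + p.2 • J) ∈ Ω}
  let F : ℝ × ℝ → Quaternion ℝ := fun p => f ((p.1 : Quaternion ℝ) + p.2 • J)
  let c : ℝ × ℝ →L[ℝ] ℝ × ℝ :=
    (ContinuousLinearMap.fst ℝ ℝ ℝ).prod (-ContinuousLinearMap.snd ℝ ℝ ℝ)
  have hFneg : ∀ x y : ℝ, F (x, -y) = f ((x : Quaternion ℝ) - y • J) := fun x y => by
    simp [F, sub_eq_add_neg]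
  have hDneg : ∀ x y : ℝ, (x, y) ∈ D → (x, -y) ∈ D := fun x y h => by
    simpa [D, sub_eq_add_neg] using hΩsymm x y h
  have hDopen : IsOpen D := by
    obtain ⟨V, hV, hVΩ⟩ := isOpen_induced_iff.mp hΩopen
    have : D = sliceCLM J ⁻¹' V := by
      ext p
      have := Set.ext_iff.mp hVΩ ⟨(p.1 : Quaternion ℝ) + p.2 • J, p.1, p.2, rfl⟩
      simpa [D, sliceCLM_apply] using this.symm
    rw [this]
    exact hV.preimage (sliceCLM J).continuous
  have hDconn : IsPreconnected D := by
    have himg : (fun q : Quaternion ℝ => (quatReCLM q, -quatReCLM (q * J))) '' Ω = D := by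
      have hL : ∀ x y : ℝ, (quatReCLM ((x : Quaternion ℝ) + y • J),
          -quatReCLM (((x : Quaternion ℝ) + y • J) * J)) = (x, y) := fun x y => by
        rw [quatReCLM_apply, quatReCLM_apply, re_slice hJ, add_mul, smul_mul_assoc, hJJ]
        simp [hJre]
      ext ⟨x, y⟩
      constructor
      · rintro ⟨q, hq, hqe⟩
        obtain ⟨s, t, rfl⟩ := hΩsub hq
        rw [← hqe]
        change (quatReCLM _, -quatReCLM _) ∈ D
        rw [hL]
        exact hq
      · intro h
        exact ⟨_, h, hL x y⟩
    rw [← himg]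
    refine hΩconn.isPreconnected.image _ (Continuous.continuousOn ?_)
    exact quatReCLM.continuous.prodMk
      (quatReCLM.continuous.comp (continuous_id.mul continuous_const)).neg
  obtain ⟨x₀, hx₀⟩ := hΩreal
  have hx₀D : (x₀, (0 : ℝ)) ∈ D := by simpa [D] using hx₀
  let α : ℝ × ℝ → Quaternion ℝ := fun p => (1 / 2 : ℝ) • (F p + F (c p))
  let β : ℝ × ℝ → Quaternion ℝ := fun p => (1 / 2 : ℝ) • (J * (F (c p) - F p))
  have hα : ∀ x y, α (x, -y) = α (x, y) := fun x y => by simp [α, c, add_comm]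
  have hβ : ∀ x y, β (x, -y) = -β (x, y) := fun x y => by
    simp only [β, c, ContinuousLinearMap.prod_apply, neg_apply,
      ContinuousLinearMap.coe_fst', ContinuousLinearMap.coe_snd', neg_neg]
    rw [← smul_neg, ← mul_neg, neg_sub]
  have hFd : ∀ p ∈ D, HasFDerivAt F (fderiv ℝ F p) p := fun p hp => (hf p.1 p.2 hp).1.hasFDerivAt
  have hFcd : ∀ p ∈ D, HasFDerivAt (fun p => F (c p)) ((fderiv ℝ F (c p)).comp c) p :=
    fun p hp => (hFd (c p) (hDneg p.1 p.2 hp)).comp p c.hasFDerivAt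
  have hαd : ∀ p ∈ D, DifferentiableAt ℝ α p := fun p hp =>
    ((hFd p hp).differentiableAt.add (hFcd p hp).differentiableAt).const_smul (1 / 2 : ℝ)
  have hβd : ∀ p ∈ D, DifferentiableAt ℝ β p := fun p hp =>
    (((hFcd p hp).differentiableAt.sub (hFd p hp).differentiableAt).const_mul J).const_smul
      (1 / 2 : ℝ)
  have hslice := fun (I : Quaternion ℝ) (hI : I ^ 2 = -1) => axialExt_slice hα hβ hI
  have hDU : ∀ I : Quaternion ℝ, I ^ 2 = -1 → ∀ p ∈ D,
      ((p.1 : Quaternion ℝ) + p.2 • I) ∈ axSymmCompletion J Ω :=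
    fun I hI p hp => ⟨p.1, p.2, I, hI, hp, rfl⟩
  have hUD : ∀ I : Quaternion ℝ, I ^ 2 = -1 → ∀ x y : ℝ,
      ((x : Quaternion ℝ) + y • I) ∈ axSymmCompletion J Ω → (x, y) ∈ D := by
    rintro I hI x y ⟨s, t, K, hK, hst, heq⟩
    have hre := congrArg QuaternionAlgebra.re heq
    rw [re_slice hI, re_slice hK] at hre
    have him := congrArg (fun q => ‖quatImCLM q‖) heq
    simp only [quatImCLM_slice hI, quatImCLM_slice hK, norm_smul, mul_one, Real.norm_eq_abs,
      norm_eq_one_of_sq_eq_neg_one hI, norm_eq_one_of_sq_eq_neg_one hK] at him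
    subst hre
    rcases abs_eq_abs.mp him with rfl | rfl
    · exact hst
    · exact hDneg x t hst
  have hgreg : SliceRegularOn (axialExt α β) (axSymmCompletion J Ω) := by
    constructor
    · rintro q ⟨x, y, I, hI, hxy, rfl⟩
      apply DifferentiableAt.differentiableWithinAt
      rcases eq_or_ne y 0 with rfl | hy
      · rw [zero_smul, add_zero]
        exact differentiableAt_axialExt_of_real hα hβ (hαd _ hxy) (hβd _ hxy)
      · have habs : (x, |y|) ∈ D := by
          rcases abs_choice y with h | h <;> rw [h]
          · exact hxy
          · exact hDneg x y hxy
        have him := quatImCLM_slice hI x y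
        have hnorm : ‖quatImCLM ((x : Quaternion ℝ) + y • I)‖ = |y| := by
          rw [him, norm_smul, norm_eq_one_of_sq_eq_neg_one hI, mul_one, Real.norm_eq_abs]
        refine differentiableAt_axialExt_of_im_ne_zero ?_ ?_ ?_
        · rw [← norm_ne_zero_iff, hnorm]
          exact abs_ne_zero.mpr hy
        · rw [hnorm, re_slice hI]
          exact hαd _ habs
        · rw [hnorm, re_slice hI]
          exact hβd _ habs
    · intro I hI x y hxy
      have hII := mul_self_of_sq_eq_neg_one hI
      have hp := hUD I hI x y hxy
      have hfun : (fun p : ℝ × ℝ => axialExt α β ((p.1 : Quaternion ℝ) + p.2 • I)) =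
          fun p => (1 / 2 : ℝ) • (F p + F (c p)) + I * ((1 / 2 : ℝ) • (J * (F (c p) - F p))) :=
        funext fun p => hslice I hI p.1 p.2
      have hder := (((hFd _ hp).add (hFcd _ hp)).const_smul (1 / 2 : ℝ)).add
        (((((hFcd _ hp).sub (hFd _ hp)).const_mul J).const_smul (1 / 2 : ℝ)).const_mul I)
      have c1 : fderiv ℝ F (x, y) (1, 0) = -(J * fderiv ℝ F (x, y) (0, 1)) :=
        eq_neg_of_add_eq_zero_left (hf x y hp).2
      have c2 : fderiv ℝ F (x, -y) (1, 0) = -(J * fderiv ℝ F (x, -y) (0, 1)) :=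
        eq_neg_of_add_eq_zero_left (hf x (-y) (hDneg x y hp)).2
      have c3 : fderiv ℝ F (x, -y) (0, -1) = -fderiv ℝ F (x, -y) (0, 1) := by
        rw [← map_neg]; simp
      rw [hfun, HasFDerivAt.fderiv (f := fun p => (1 / 2 : ℝ) • (F p + F (c p)) +
        I * ((1 / 2 : ℝ) • (J * (F (c p) - F p)))) hder]
      simp [c, c1, c2, c3, mul_add, mul_sub, ← mul_assoc, hII, hJJ]
      module
  have hgf : Set.EqOn (axialExt α β) f Ω := by
    intro q hq
    obtain ⟨x, y, rfl⟩ := hΩsub hq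
    rw [hslice J hJ]
    simp only [α, β, mul_smul_comm, ← mul_assoc, hJJ, neg_mul, one_mul]
    change _ = F (x, y)
    module
  refine ⟨axialExt α β, ?_, hgreg, hgf, ?_⟩
  · intro I hI x y _
    rw [hslice I hI, ← hFneg]
    rfl
  · rintro h ⟨hhd, hhcr⟩ hhf q ⟨x, y, I, hI, hxy, rfl⟩
    have hdiff : ∀ u : Quaternion ℝ → Quaternion ℝ, DifferentiableOn ℝ u (axSymmCompletion J Ω) →
        ∀ p ∈ D, DifferentiableAt ℝ (fun p : ℝ × ℝ => u ((p.1 : Quaternion ℝ) + p.2 • I)) p := by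
      intro u hu p hp
      have h1 : DifferentiableOn ℝ (u ∘ sliceCLM I) D :=
        hu.comp (sliceCLM I).differentiable.differentiableOn fun p hp => by
          rw [sliceCLM_apply]
          exact hDU I hI p hp
      have h2 := (h1 p hp).differentiableAt (hDopen.mem_nhds hp)
      exact h2.congr_of_eventuallyEq (Eventually.of_forall fun p => by
        simp [sliceCLM_apply])
    have hkey := eq_zero_of_cauchyRiemann_of_real hI hDopen hDconn
      (k := (fun p : ℝ × ℝ => h ((p.1 : Quaternion ℝ) + p.2 • I)) -
        fun p : ℝ × ℝ => axialExt α β ((p.1 : Quaternion ℝ) + p.2 • I)) (fun p hp => by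
        have h1 := hdiff h hhd p hp
        have h2 := hdiff _ hgreg.1 p hp
        refine ⟨h1.sub h2, ?_⟩
        rw [fderiv_sub h1 h2]
        have e1 := hhcr I hI p.1 p.2 (hDU I hI p hp)
        have e2 := hgreg.2 I hI p.1 p.2 (hDU I hI p hp)
        rw [sub_apply, sub_apply, mul_sub,
          sub_add_sub_comm, e1, e2, sub_zero]) hx₀D (fun t ht => by
        have ht' : (t : Quaternion ℝ) ∈ Ω := by simpa [D] using ht
        simp [hhf ht', hgf ht']) (p := (x, y)) hxy
    exact sub_eq_zero.mp hkey
end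
end

section
/- Quaternionic Riemann mapping theorem: let Ω ∈ 𝔯(ℍ) be nonempty with Ω ∩ ℂ_I ≠ ℂ_I for every unit imaginary quaternion I, let 𝔹 be the open unit ball of ℍ, and let x₀ ∈ Ω ∩ ℝ. Then there exists a unique quaternionic intrinsic slice regular function f : Ω → 𝔹 which is bijective and satisfies f(x₀) = 0 and f′(x₀) > 0, where f′ is the slice derivative. -/
noncomputable section

open Set Filter Topology Metric

/-- An injective holomorphic function on an open set has nonvanishing derivative. -/
theorem deriv_ne_zero_of_injOn {U : Set ℂ} (hU : IsOpen U) {f : ℂ → ℂ}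
    (hf : DifferentiableOn ℂ f U) (hinj : InjOn f U) {c : ℂ} (hc : c ∈ U) : deriv f c ≠ 0 := by
  have hfa : AnalyticAt ℂ (fun z ↦ f z - f c) c :=
    (hf.analyticAt (hU.mem_nhds hc)).sub analyticAt_const
  have hUc : U ∈ 𝓝 c := hU.mem_nhds hc
  have htop : analyticOrderAt (fun z ↦ f z - f c) c ≠ ⊤ := by
    rw [Ne, analyticOrderAt_eq_top]
    intro h
    have h2 : ∀ᶠ z in 𝓝[≠] c, False := by
      filter_upwards [h.filter_mono nhdsWithin_le_nhds, nhdsWithin_le_nhds hUc,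
        self_mem_nhdsWithin] with z hz hzU hzc
      exact hzc (hinj hzU hc (sub_eq_zero.1 hz))
    exact h2.exists.elim fun _ h ↦ h
  obtain ⟨g, hg, hgc, hfg⟩ := hfa.analyticOrderAt_ne_top.1 htop
  set n := analyticOrderNatAt (fun z ↦ f z - f c) c
  have hn0 : n ≠ 0 := by
    intro h0
    have := hfg.self_of_nhds
    simp [h0] at this
    exact hgc this.symm
  set ψ : ℂ → ℂ := fun z ↦ (z - c) * (g z / g c) ^ (1 / n : ℂ)
  have hψ : HasStrictDerivAt ψ 1 c := by
    have h1 : HasStrictDerivAt (fun z ↦ z - c) 1 c := (hasStrictDerivAt_id c).sub_const c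
    have h2 : HasStrictDerivAt (fun z ↦ (g z / g c) ^ (1 / n : ℂ)) _ c :=
      (hg.hasStrictDerivAt.div_const (g c)).cpow_const (by simp [hgc])
    simpa [ψ, hgc] using h1.fun_mul h2
  have hψc : ψ c = 0 := by simp [ψ]
  have hpow : ∀ᶠ z in 𝓝 c, f z - f c = g c * ψ z ^ n := by
    filter_upwards [hfg] with z hz
    simp only [hz, ψ, mul_pow, smul_eq_mul, one_div]
    rw [Complex.cpow_nat_inv_pow _ hn0]
    field_simp
  rcases eq_or_ne n 1 with h1 | h1
  · rw [h1] at hpow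
    have : HasDerivAt (fun z ↦ f z - f c) (g c) c := by
      refine HasDerivAt.congr_of_eventuallyEq ?_ hpow
      simpa using hψ.hasDerivAt.const_mul (g c)
    have h3 : HasDerivAt f (g c) c := by simpa using this.add_const (f c)
    rwa [h3.deriv]
  exfalso
  obtain ⟨V, hV, hVo, hcV⟩ := _root_.eventually_nhds_iff.1 (hpow.and hUc)
  have himg : ψ '' V ∈ 𝓝 (0 : ℂ) := by
    rw [← hψc, ← hψ.map_nhds_eq one_ne_zero]
    exact image_mem_map (hVo.mem_nhds hcV)
  obtain ⟨ε, hε, hεV⟩ := Metric.mem_nhds_iff.1 himg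
  set ζ := Complex.exp (2 * Real.pi * Complex.I / n)
  have hζ : IsPrimitiveRoot ζ n := Complex.isPrimitiveRoot_exp n hn0
  have hζn : ‖ζ‖ = 1 := hζ.norm'_eq_one hn0
  have hw : ‖((ε / 2 : ℝ) : ℂ)‖ = ε / 2 := by
    rw [Complex.norm_real, Real.norm_of_nonneg (by positivity)]
  obtain ⟨a, haV, ha⟩ := hεV (show ((ε / 2 : ℝ) : ℂ) ∈ ball 0 ε by
    rw [mem_ball_zero_iff, hw]; linarith)
  obtain ⟨b, hbV, hb⟩ := hεV (show ζ * ((ε / 2 : ℝ) : ℂ) ∈ ball 0 ε by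
    rw [mem_ball_zero_iff, norm_mul, hζn, hw]; linarith)
  have hab : a = b := by
    refine hinj (hV a haV).2 (hV b hbV).2 (sub_left_injective (b := f c) ?_)
    simp only [(hV a haV).1, (hV b hbV).1, ha, hb, mul_pow, hζ.pow_eq_one, one_mul]
  have hne : ((ε / 2 : ℝ) : ℂ) ≠ 0 := by exact_mod_cast (half_pos hε).ne'
  have : ζ = 1 := by
    rw [← hab, ha] at hb
    exact (mul_right_cancel₀ hne (by rw [← hb, one_mul]))
  exact hζ.ne_one (by omega) this

/-- Compactness of the family of holomorphic maps into the closed unit disc, along ultrafilters. -/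
theorem exists_tendstoLocallyUniformlyOn_ultrafilter {ι : Type*} (l : Ultrafilter ι)
    {F : ι → ℂ → ℂ} {U : Set ℂ} (hU : IsOpen U) (hF : ∀ i, DifferentiableOn ℂ (F i) U)
    (hb : ∀ i, MapsTo (F i) U (closedBall 0 1)) :
    ∃ f : ℂ → ℂ, TendstoLocallyUniformlyOn F f l U := by
  have hlim : ∀ z, ∃ w, z ∈ U → Tendsto (fun i ↦ F i z) l (𝓝 w) := by
    intro z
    by_cases hz : z ∈ U
    · obtain ⟨w, -, hw⟩ := (isCompact_closedBall (0 : ℂ) 1).ultrafilter_le_nhds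
        (l.map fun i ↦ F i z) (le_principal_iff.2 <| mem_map.2 <| Filter.univ_mem' fun i ↦ hb i hz)
      exact ⟨w, fun _ ↦ hw⟩
    · exact ⟨0, fun h ↦ (hz h).elim⟩
  choose f hf using hlim
  refine ⟨f, Metric.tendstoLocallyUniformlyOn_iff.2 fun ε hε x hx ↦ ?_⟩
  obtain ⟨r, hr, hrU⟩ := Metric.isOpen_iff.1 hU x hx
  have hFx : ∀ i, ∀ y ∈ ball x r, dist (F i y) (F i x) ≤ 2 / r * dist y x := by
    intro i y hy
    refine Complex.dist_le_div_mul_dist_of_mapsTo_ball ((hF i).mono hrU) (fun z hz ↦ ?_) hy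
    have h1 := hb i (hrU hz)
    have h2 := hb i hx
    rw [mem_closedBall] at *
    linarith [dist_triangle_right (F i z) (F i x) 0]
  have hfx : ∀ y ∈ ball x r, dist (f y) (f x) ≤ 2 / r * dist y x := fun y hy ↦
    le_of_tendsto ((hf y (hrU hy)).dist (hf x hx)) (Eventually.of_forall fun i ↦ hFx i y hy)
  refine ⟨ball x (min r (ε / 4 * (r / 2))),
    mem_nhdsWithin_of_mem_nhds (ball_mem_nhds _ (by positivity)), ?_⟩
  filter_upwards [(hf x hx).eventually (ball_mem_nhds _ (show 0 < ε / 4 by positivity))]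
    with i hi y hy
  have hyr : y ∈ ball x r := ball_subset_ball (min_le_left _ _) hy
  have hyd : 2 / r * dist y x ≤ ε / 4 := by
    have : dist y x ≤ ε / 4 * (r / 2) := (hy.trans_le (min_le_right _ _)).le
    calc 2 / r * dist y x ≤ 2 / r * (ε / 4 * (r / 2)) := by gcongr
      _ = ε / 4 := by field_simp
  have h1 := hFx i y hyr
  have h2 := hfx y hyr
  replace hi : dist (F i x) (f x) < ε / 4 := hi
  have h3 := dist_triangle4 (f y) (f x) (F i x) (F i y)
  rw [dist_comm (f x), dist_comm (F i x) (F i y)] at h3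
  linarith

/-- A locally uniform limit of injective holomorphic functions is injective, unless its derivative
vanishes identically (a version of Hurwitz's theorem). -/
theorem injOn_of_tendstoLocallyUniformlyOn {ι : Type*} {l : Filter ι} [l.NeBot]
    {F : ι → ℂ → ℂ} {f : ℂ → ℂ} {U : Set ℂ} (h : TendstoLocallyUniformlyOn F f l U)
    (hU : IsOpen U) (hUc : IsPreconnected U) (hF : ∀ i, DifferentiableOn ℂ (F i) U)
    (hinj : ∀ i, InjOn (F i) U) {x : ℂ} (hx : x ∈ U) (hfx : deriv f x ≠ 0) : InjOn f U := by
  have hf : DifferentiableOn ℂ f U := h.differentiableOn (Eventually.of_forall hF) hU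
  have hfa : AnalyticOnNhd ℂ f U := hf.analyticOnNhd hU
  intro a ha b hb hab
  by_contra hne
  have hiso : ∀ᶠ z in 𝓝[≠] a, f z ≠ f a := by
    rcases (hfa a ha).eventually_eq_or_eventually_ne (analyticAt_const (v := f a)) with h1 | h1
    · exfalso
      have h2 : EqOn f (fun _ ↦ f a) U :=
        hfa.eqOn_of_preconnected_of_eventuallyEq analyticOnNhd_const hUc ha h1
      apply hfx
      rw [(h2.eventuallyEq_of_mem (hU.mem_nhds hx)).deriv_eq]
      simp
    · exact h1
  have hiso' : ∀ᶠ z in 𝓝 a, z ∈ U ∧ z ≠ b ∧ (z ≠ a → f z ≠ f a) :=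
    (hU.eventually_mem ha).and
      ((isOpen_ne.eventually_mem hne).and (eventually_nhdsWithin_iff.1 hiso))
  obtain ⟨r, hr, hrb⟩ := Metric.nhds_basis_closedBall.eventually_iff.1 hiso'
  have hsub : closedBall a r ⊆ U := fun z hz ↦ (hrb hz).1
  have hsph : (sphere a r).Nonempty := NormedSpace.sphere_nonempty.2 hr.le
  obtain ⟨z₀, hz₀, hmin⟩ := (isCompact_sphere a r).exists_isMinOn hsph
    (f := fun z ↦ ‖f z - f a‖)
    (((hf.continuousOn.mono (sphere_subset_closedBall.trans hsub)).sub continuousOn_const).norm)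
  set m := ‖f z₀ - f a‖
  have hm : 0 < m := norm_pos_iff.2 <| sub_ne_zero.2 <|
    (hrb (sphere_subset_closedBall hz₀)).2.2 (ne_of_mem_sphere hz₀ hr.ne')
  have hunif : TendstoUniformlyOn F f l (closedBall a r) :=
    (tendstoLocallyUniformlyOn_iff_forall_isCompact hU).1 h _ hsub (isCompact_closedBall a r)
  have hta := h.tendsto_at ha
  have htb := h.tendsto_at hb
  rw [← hab] at htb
  have hev : ∀ᶠ i in l, dist (F i b) (F i a) < m / 2 / 2 := by
    have := hta.dist htb
    rw [dist_self] at this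
    filter_upwards [this.eventually (gt_mem_nhds (show 0 < m / 2 / 2 by positivity))] with i hi
    rwa [dist_comm]
  obtain ⟨i, hi, hib⟩ := ((Metric.tendstoUniformlyOn_iff.1 hunif (m / 4) (by positivity)).and
    hev).exists
  have hdc : DiffContOnCl ℂ (F i) (ball a r) :=
    ((hF i).mono hsub).diffContOnCl_ball subset_rfl
  have hsphere : ∀ z ∈ sphere a r, m / 2 ≤ ‖F i z - F i a‖ := by
    intro z hz
    have h1 : m ≤ ‖f z - f a‖ := hmin hz
    have h2 := hi z (sphere_subset_closedBall hz)
    have h3 := hi a (mem_closedBall_self hr.le)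
    have h4 := dist_triangle4 (f z) (F i z) (F i a) (f a)
    rw [dist_comm (F i a) (f a)] at h4
    rw [← dist_eq_norm] at *
    linarith
  have hfreq : ∃ᶠ z in 𝓝 a, F i z ≠ F i a := by
    have h1 : ∀ᶠ z in 𝓝[≠] a, F i z ≠ F i a := by
      filter_upwards [nhdsWithin_le_nhds (hU.mem_nhds ha), self_mem_nhdsWithin] with z hz hza heq
      exact hza (hinj i hz ha heq)
    exact h1.frequently.filter_mono nhdsWithin_le_nhds
  obtain ⟨z, hz, hzb⟩ := hdc.ball_subset_image_closedBall hr hsphere hfreq hib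
  exact (hrb hz).2.1 (hinj i (hsub hz) hb hzb)

/-- The automorphism of the unit disc sending `a` to `0`. -/
def diskAut (a z : ℂ) : ℂ := (z - a) / (1 - starRingEnd ℂ a * z)

theorem one_sub_conj_mul_ne_zero {a z : ℂ} (ha : ‖a‖ < 1) (hz : ‖z‖ < 1) :
    1 - starRingEnd ℂ a * z ≠ 0 := by
  intro h
  have h1 : ‖starRingEnd ℂ a * z‖ = 1 := by rw [← sub_eq_zero.1 h, norm_one]
  rw [norm_mul, RCLike.norm_conj] at h1
  nlinarith [norm_nonneg a, norm_nonneg z]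

theorem hasDerivAt_diskAut {a z : ℂ} (ha : ‖a‖ < 1) (hz : ‖z‖ < 1) :
    HasDerivAt (diskAut a) ((1 - ‖a‖ ^ 2 : ℂ) / (1 - starRingEnd ℂ a * z) ^ 2) z := by
  have h1 : HasDerivAt (fun z ↦ z - a) 1 z := (hasDerivAt_id z).sub_const a
  have h2 : HasDerivAt (fun z ↦ 1 - starRingEnd ℂ a * z) (-starRingEnd ℂ a) z := by
    simpa using ((hasDerivAt_id z).const_mul (starRingEnd ℂ a)).const_sub 1
  convert! h1.div h2 (one_sub_conj_mul_ne_zero ha hz) using 2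
  rw [← Complex.conj_mul']
  ring

theorem norm_diskAut_lt_one {a z : ℂ} (ha : ‖a‖ < 1) (hz : ‖z‖ < 1) : ‖diskAut a z‖ < 1 := by
  rw [diskAut, norm_div, div_lt_one (norm_pos_iff.2 (one_sub_conj_mul_ne_zero ha hz)),
    ← sq_lt_sq₀ (norm_nonneg _) (norm_nonneg _), ← Complex.normSq_eq_norm_sq,
    ← Complex.normSq_eq_norm_sq]
  have ha' : Complex.normSq a < 1 := by
    rw [Complex.normSq_eq_norm_sq]; nlinarith [norm_nonneg a]
  have hz' : Complex.normSq z < 1 := by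
    rw [Complex.normSq_eq_norm_sq]; nlinarith [norm_nonneg z]
  have key : Complex.normSq (1 - starRingEnd ℂ a * z) - Complex.normSq (z - a)
      = (1 - Complex.normSq a) * (1 - Complex.normSq z) := by
    simp [Complex.normSq_apply]; ring
  nlinarith [mul_pos (sub_pos.2 ha') (sub_pos.2 hz')]

theorem diskAut_self (a : ℂ) : diskAut a a = 0 := by simp [diskAut]

theorem diskAut_injOn {a : ℂ} (ha : ‖a‖ < 1) : InjOn (diskAut a) (ball 0 1) := by
  intro z hz w hw h
  rw [mem_ball_zero_iff] at hz hw
  rw [diskAut, diskAut, div_eq_div_iff (one_sub_conj_mul_ne_zero ha hz)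
    (one_sub_conj_mul_ne_zero ha hw)] at h
  have h1 : (1 - starRingEnd ℂ a * a) * (z - w) = 0 := by linear_combination h
  exact sub_eq_zero.1 ((mul_eq_zero.1 h1).resolve_left (one_sub_conj_mul_ne_zero ha ha))

theorem hasDerivAt_of_sq_eq {s g : ℂ → ℂ} {z g' : ℂ} (hs : ContinuousAt s z)
    (hsq : ∀ w, s w ^ 2 = g w) (hg : HasDerivAt g g' z) (h0 : s z ≠ 0) :
    HasDerivAt s (g' / (2 * s z)) z := by
  rw [hasDerivAt_iff_tendsto_slope] at hg ⊢
  have hsum : Tendsto (fun w ↦ s w + s z) (𝓝[≠] z) (𝓝 (2 * s z)) := by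
    rw [two_mul]
    exact (hs.tendsto.mono_left nhdsWithin_le_nhds).add_const _
  refine (hg.div hsum (by simpa using h0)).congr' ?_
  filter_upwards [hsum.eventually_ne (show 2 * s z ≠ 0 by simpa using h0)] with w hw
  simp only [slope_def_field, Pi.div_apply, ← hsq]
  rw [div_eq_iff hw]
  ring

/-- Injective holomorphic maps from `U` to the unit disc sending `x` to `0`. -/
structure IsDiskEmbedding (U : Set ℂ) (x : ℂ) (f : ℂ → ℂ) : Prop where
  differentiableOn : DifferentiableOn ℂ f U
  injOn : InjOn f U
  norm_lt_one : ∀ z ∈ U, ‖f z‖ < 1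
  map_base : f x = 0

theorem IsDiskEmbedding.diskAut_comp {U : Set ℂ} {f : ℂ → ℂ} {x : ℂ} (hx : x ∈ U)
    (hf : DifferentiableOn ℂ f U) (hinj : InjOn f U) (hb : ∀ z ∈ U, ‖f z‖ < 1) :
    IsDiskEmbedding U x (diskAut (f x) ∘ f) where
  differentiableOn z hz := (hasDerivAt_diskAut (hb x hx) (hb z hz)).differentiableAt
    |>.comp_differentiableWithinAt z (hf z hz)
  injOn := (diskAut_injOn (hb x hx)).comp hinj fun z hz ↦ mem_ball_zero_iff.2 (hb z hz)
  norm_lt_one z hz := norm_diskAut_lt_one (hb x hx) (hb z hz)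
  map_base := diskAut_self _

theorem exists_isDiskEmbedding {U : Set ℂ} (hU : IsOpen U) (hUc : IsSimplyConnected U)
    (hne : U ≠ univ) {x : ℂ} (hx : x ∈ U) : ∃ f, IsDiskEmbedding U x f := by
  obtain ⟨a, ha⟩ := (ne_univ_iff_exists_notMem U).1 hne
  have hg0 : ∀ z ∈ U, z - a ≠ 0 := fun z hz h ↦ ha (by rwa [← sub_eq_zero.1 h])
  obtain ⟨s, hs, hsq⟩ := Complex.exists_continuousOn_pow_eq hUc hU (g := fun z ↦ z - a)
    (by fun_prop) (by rintro ⟨z, hz, h⟩; exact hg0 z hz h) two_ne_zero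
  have hs0 : ∀ z ∈ U, s z ≠ 0 := fun z hz h ↦ hg0 z hz (by rw [← hsq, h]; simp)
  have hsd : DifferentiableOn ℂ s U := fun z hz ↦
    (hasDerivAt_of_sq_eq (hs.continuousAt (hU.mem_nhds hz)) hsq
      ((hasDerivAt_id z).sub_const a) (hs0 z hz)).differentiableAt.differentiableWithinAt
  have hsx : 0 < ‖s x‖ := norm_pos_iff.2 (hs0 x hx)
  obtain ⟨ε, hε, hεs⟩ : ∃ ε > 0, ∀ z ∈ U, ε < ‖s z + s x‖ := by
    obtain ⟨δ, hδ, hδs⟩ := Metric.continuousWithinAt_iff.1 (hs x hx) ‖s x‖ hsx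
    refine ⟨min ‖s x‖ (δ / 2 / (3 * ‖s x‖)), by positivity, fun z hz ↦ ?_⟩
    by_contra! h
    have h1 : ‖s z + s x‖ ≤ ‖s x‖ := h.trans (min_le_left _ _)
    have h2 : ‖s z + s x‖ ≤ δ / 2 / (3 * ‖s x‖) := h.trans (min_le_right _ _)
    have h3 : ‖s z - s x‖ ≤ 3 * ‖s x‖ := by
      calc ‖s z - s x‖ = ‖(s z + s x) - 2 * s x‖ := by ring_nf
        _ ≤ ‖s z + s x‖ + ‖2 * s x‖ := norm_sub_le _ _
        _ ≤ 3 * ‖s x‖ := by rw [norm_mul, Complex.norm_ofNat]; linarith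
    have h4 : dist z x < δ := by
      have : z - x = (s z + s x) * (s z - s x) := by linear_combination hsq x - hsq z
      rw [dist_eq_norm, this, norm_mul]
      calc ‖s z + s x‖ * ‖s z - s x‖ ≤ δ / 2 / (3 * ‖s x‖) * (3 * ‖s x‖) := by gcongr
        _ = δ / 2 := by field_simp
        _ < δ := half_lt_self hδ
    have h5 := hδs hz h4
    rw [dist_eq_norm] at h5
    have h6 : ‖(s z + s x) - (s z - s x)‖ = 2 * ‖s x‖ := by
      rw [← Complex.norm_ofNat 2, ← norm_mul]; ring_nf
    linarith [norm_sub_le (s z + s x) (s z - s x)]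
  have hne0 : ∀ z ∈ U, s z + s x ≠ 0 := fun z hz ↦ norm_pos_iff.1 (hε.trans (hεs z hz))
  refine ⟨_, IsDiskEmbedding.diskAut_comp (f := fun z ↦ ε / (s z + s x)) hx ?_ ?_ ?_⟩
  · exact (differentiableOn_const _).div (hsd.add_const _) hne0
  · intro z hz w hw h
    have hε' : (ε : ℂ) ≠ 0 := by exact_mod_cast hε.ne'
    simp only [div_eq_div_iff (hne0 z hz) (hne0 w hw)] at h
    have h1 : s z = s w := (add_right_cancel (mul_left_cancel₀ hε' h)).symm
    have h2 := hsq z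
    rw [h1, hsq w] at h2
    exact (sub_left_injective h2).symm
  · intro z hz
    rw [norm_div, Complex.norm_real, Real.norm_of_nonneg hε.le,
      div_lt_one (hε.trans (hεs z hz))]
    exact hεs z hz

/-- A disc embedding that is not onto can be replaced by one with a larger derivative. -/
theorem IsDiskEmbedding.exists_norm_deriv_lt {U : Set ℂ} (hU : IsOpen U)
    (hUc : IsSimplyConnected U) {x : ℂ} (hx : x ∈ U) {f : ℂ → ℂ} (hf : IsDiskEmbedding U x f)
    {w : ℂ} (hw : ‖w‖ < 1) (hwf : w ∉ f '' U) :
    ∃ k, IsDiskEmbedding U x k ∧ ‖deriv f x‖ < ‖deriv k x‖ := by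
  set g : ℂ → ℂ := diskAut w ∘ f with hg
  have hgd : ∀ z ∈ U, HasDerivAt g
      ((1 - ‖w‖ ^ 2 : ℂ) / (1 - starRingEnd ℂ w * f z) ^ 2 * deriv f z) z := fun z hz ↦
    (hasDerivAt_diskAut hw (hf.norm_lt_one z hz)).comp z
      (hf.differentiableOn.differentiableAt (hU.mem_nhds hz)).hasDerivAt
  have hg0 : ∀ z ∈ U, g z ≠ 0 := by
    intro z hz h
    rw [← diskAut_self w] at h
    exact hwf ⟨z, hz, diskAut_injOn hw (mem_ball_zero_iff.2 (hf.norm_lt_one z hz))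
      (mem_ball_zero_iff.2 hw) h⟩
  obtain ⟨s, hs, hsq⟩ := Complex.exists_continuousOn_pow_eq hUc hU (g := g)
    (fun z hz ↦ (hgd z hz).continuousAt.continuousWithinAt)
    (by rintro ⟨z, hz, h⟩; exact hg0 z hz h) two_ne_zero
  have hs0 : ∀ z ∈ U, s z ≠ 0 := fun z hz h ↦ hg0 z hz (by rw [← hsq, h]; simp)
  have hsd : ∀ z ∈ U, HasDerivAt s _ z := fun z hz ↦
    hasDerivAt_of_sq_eq (hs.continuousAt (hU.mem_nhds hz)) hsq (hgd z hz) (hs0 z hz)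
  have hs1 : ∀ z ∈ U, ‖s z‖ < 1 := by
    intro z hz
    have h1 : ‖g z‖ < 1 := norm_diskAut_lt_one hw (hf.norm_lt_one z hz)
    rw [← hsq, norm_pow] at h1
    exact (sq_lt_one_iff₀ (norm_nonneg _)).1 h1
  have hsinj : InjOn s U := by
    intro z hz y hy h
    refine hf.injOn hz hy (diskAut_injOn hw (mem_ball_zero_iff.2 (hf.norm_lt_one z hz))
      (mem_ball_zero_iff.2 (hf.norm_lt_one y hy)) ?_)
    change g z = g y
    rw [← hsq, ← hsq, h]
  have hk := IsDiskEmbedding.diskAut_comp hx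
    (fun z hz ↦ (hsd z hz).differentiableAt.differentiableWithinAt) hsinj hs1
  refine ⟨_, hk, ?_⟩
  have hfx : 0 < ‖deriv f x‖ :=
    norm_pos_iff.2 (deriv_ne_zero_of_injOn hU hf.differentiableOn hf.injOn hx)
  have hbw : ‖w‖ = ‖s x‖ ^ 2 := by
    rw [← norm_pow, hsq, hg, Function.comp, hf.map_base]
    simp [diskAut]
  set b := ‖s x‖ with hb
  have hb0 : 0 < b := norm_pos_iff.2 (hs0 x hx)
  have hb1 : b < 1 := hs1 x hx
  rw [((hasDerivAt_diskAut (hs1 x hx) (hs1 x hx)).comp x (hsd x hx)).deriv]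
  have hbb : 0 < 1 - b ^ 2 := by nlinarith
  have hbb' : 0 < 1 - b ^ 4 := by nlinarith [sq_nonneg b]
  have e1 : (1 - (b : ℂ) ^ 2) = ((1 - b ^ 2 : ℝ) : ℂ) := by push_cast; ring
  have e2 : (1 - ((b ^ 2 : ℝ) : ℂ) ^ 2) = ((1 - b ^ 4 : ℝ) : ℂ) := by push_cast; ring
  rw [Complex.conj_mul', ← hb, hf.map_base, hbw, e1, e2]
  simp only [mul_zero, sub_zero, one_pow, div_one, norm_mul, norm_div, norm_pow,
    Complex.norm_real, Real.norm_of_nonneg hbb.le, Real.norm_of_nonneg hbb'.le,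
    Complex.norm_ofNat, ← hb]
  have key : (1 - b ^ 2) / (1 - b ^ 2) ^ 2 * ((1 - b ^ 4) * ‖deriv f x‖ / (2 * b))
      = ‖deriv f x‖ * ((1 + b ^ 2) / (2 * b)) := by
    field_simp
    ring
  rw [key]
  refine lt_mul_of_one_lt_right hfx ?_
  rw [one_lt_div (by positivity)]
  nlinarith [sq_pos_of_pos (sub_pos.2 hb1)]

/-- The Riemann mapping theorem: existence of a biholomorphism onto the unit disc. -/
theorem exists_isDiskEmbedding_surjOn {U : Set ℂ} (hU : IsOpen U) (hUc : IsSimplyConnected U)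
    (hne : U ≠ univ) {x : ℂ} (hx : x ∈ U) :
    ∃ f, IsDiskEmbedding U x f ∧ SurjOn f U (ball 0 1) := by
  set S : Set ℝ := {t | ∃ f, IsDiskEmbedding U x f ∧ ‖deriv f x‖ = t}
  have hSne : S.Nonempty := (exists_isDiskEmbedding hU hUc hne hx).elim fun f hf ↦ ⟨_, f, hf, rfl⟩
  have hSb : BddAbove S := by
    obtain ⟨r, hr, hrU⟩ := Metric.isOpen_iff.1 hU x hx
    refine ⟨1 / r, ?_⟩
    rintro _ ⟨f, hf, rfl⟩
    refine Complex.norm_deriv_le_div_of_mapsTo_ball (hf.differentiableOn.mono hrU)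
      (fun z hz ↦ ?_) hr
    rw [hf.map_base, mem_closedBall_zero_iff]
    exact (hf.norm_lt_one z (hrU hz)).le
  obtain ⟨u, -, hu, huS⟩ := exists_seq_tendsto_sSup hSne hSb
  choose F hF hFu using huS
  obtain ⟨f, hf⟩ := exists_tendstoLocallyUniformlyOn_ultrafilter (hyperfilter ℕ) hU
    (fun i ↦ (hF i).differentiableOn)
    (fun i z hz ↦ mem_closedBall_zero_iff.2 ((hF i).norm_lt_one z hz).le)
  have hFd : ∀ i, DifferentiableOn ℂ (F i) U := fun i ↦ (hF i).differentiableOn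
  have hfd : DifferentiableOn ℂ f U := hf.differentiableOn (Eventually.of_forall hFd) hU
  have hderiv : ‖deriv f x‖ = sSup S := by
    have h1 := ((hf.deriv (Eventually.of_forall hFd) hU).tendsto_at hx).norm
    refine tendsto_nhds_unique h1 ?_
    refine (hu.mono_left ?_).congr fun i ↦ (hFu i).symm
    simpa [Nat.cofinite_eq_atTop] using hyperfilter_le_cofinite (α := ℕ)
  have hd0 : deriv f x ≠ 0 := by
    obtain ⟨g, hg⟩ := exists_isDiskEmbedding hU hUc hne hx
    have h1 := norm_pos_iff.2 (deriv_ne_zero_of_injOn hU hg.differentiableOn hg.injOn hx)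
    rw [← norm_pos_iff, hderiv]
    exact h1.trans_le (le_csSup hSb ⟨g, hg, rfl⟩)
  have hpre : IsPreconnected U := hUc.isPathConnected.isConnected.isPreconnected
  have hinj : InjOn f U := injOn_of_tendstoLocallyUniformlyOn hf hU hpre hFd
    (fun i ↦ (hF i).injOn) hx hd0
  have hle : ∀ z ∈ U, ‖f z‖ ≤ 1 := fun z hz ↦ le_of_tendsto (hf.tendsto_at hz).norm
    (Eventually.of_forall fun i ↦ ((hF i).norm_lt_one z hz).le)
  have hlt : ∀ z ∈ U, ‖f z‖ < 1 := by
    intro z hz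
    refine lt_of_le_of_ne (hle z hz) fun h ↦ hd0 ?_
    have hmax : IsMaxOn (norm ∘ f) U z := fun y hy ↦ by
      simpa [h] using hle y hy
    have h2 := Complex.eqOn_of_isPreconnected_of_isMaxOn_norm hpre hU hfd hz hmax
    rw [(h2.eventuallyEq_of_mem (hU.mem_nhds hx)).deriv_eq]
    exact deriv_const x (f z)
  have hfx : f x = 0 := tendsto_nhds_unique (hf.tendsto_at hx)
    (tendsto_const_nhds.congr fun i ↦ (hF i).map_base.symm)
  have hfe : IsDiskEmbedding U x f := ⟨hfd, hinj, hlt, hfx⟩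
  refine ⟨f, hfe, fun w hw ↦ ?_⟩
  by_contra hwf
  obtain ⟨k, hk, hlt⟩ := hfe.exists_norm_deriv_lt hU hUc hx (mem_ball_zero_iff.1 hw) hwf
  rw [hderiv] at hlt
  exact hlt.not_ge (le_csSup hSb ⟨k, hk, rfl⟩)

theorem differentiableAt_invFunOn {U : Set ℂ} (hU : IsOpen U) {f : ℂ → ℂ}
    (hf : DifferentiableOn ℂ f U) (hinj : InjOn f U) {z : ℂ} (hz : z ∈ U) :
    DifferentiableAt ℂ (Function.invFunOn f U) (f z) :=
  ((hf.analyticAt (hU.mem_nhds hz)).hasStrictDerivAt.to_local_left_inverse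
    (deriv_ne_zero_of_injOn hU hf hinj hz)
    ((hU.eventually_mem hz).mono fun _ hy ↦ hinj.leftInvOn_invFunOn hy)
    ).hasDerivAt.differentiableAt

theorem IsDiskEmbedding.exists_transition {U : Set ℂ} (hU : IsOpen U) {x : ℂ} (hx : x ∈ U)
    {f g : ℂ → ℂ} (hf : IsDiskEmbedding U x f) (hfs : SurjOn f U (ball 0 1))
    (hg : IsDiskEmbedding U x g) :
    ∃ h : ℂ → ℂ, DifferentiableOn ℂ h (ball 0 1) ∧ MapsTo h (ball 0 1) (closedBall (h 0) 1) ∧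
      h 0 = 0 ∧ deriv g x = deriv h 0 * deriv f x ∧ ∀ z ∈ U, g z = h (f z) := by
  have hinv : ∀ z ∈ U, Function.invFunOn f U (f z) = z := fun z hz ↦
    hf.injOn.leftInvOn_invFunOn hz
  have hgh : ∀ z ∈ U, g z = (g ∘ Function.invFunOn f U) (f z) := fun z hz ↦ by
    rw [Function.comp, hinv z hz]
  have h0 : (g ∘ Function.invFunOn f U) 0 = 0 := by
    have := hgh x hx
    rwa [hf.map_base, hg.map_base, eq_comm] at this
  have hd : DifferentiableOn ℂ (g ∘ Function.invFunOn f U) (ball 0 1) := by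
    intro w hw
    obtain ⟨z, hz, rfl⟩ := hfs hw
    refine (DifferentiableAt.comp _ ?_
      (differentiableAt_invFunOn hU hf.differentiableOn hf.injOn hz)).differentiableWithinAt
    rw [hinv z hz]
    exact hg.differentiableOn.differentiableAt (hU.mem_nhds hz)
  refine ⟨_, hd, fun w hw ↦ ?_, h0, ?_, hgh⟩
  · obtain ⟨z, hz, rfl⟩ := hfs hw
    rw [h0, mem_closedBall_zero_iff, ← hgh z hz]
    exact (hg.norm_lt_one z hz).le
  · have h1 : g =ᶠ[𝓝 x] (g ∘ Function.invFunOn f U) ∘ f :=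
      EqOn.eventuallyEq_of_mem hgh (hU.mem_nhds hx)
    rw [h1.deriv_eq, deriv_comp _ _ (hf.differentiableOn.differentiableAt (hU.mem_nhds hx)),
      hf.map_base]
    rw [hf.map_base]
    exact hd.differentiableAt (ball_mem_nhds _ one_pos)

/-- Uniqueness in the Riemann mapping theorem. -/
theorem IsDiskEmbedding.eqOn {U : Set ℂ} (hU : IsOpen U) {x : ℂ} (hx : x ∈ U)
    {f g : ℂ → ℂ} (hf : IsDiskEmbedding U x f) (hfs : SurjOn f U (ball 0 1))
    (hg : IsDiskEmbedding U x g) (hgs : SurjOn g U (ball 0 1))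
    {r t : ℝ} (hr : 0 < r) (ht : 0 < t) (hfr : deriv f x = r) (hgt : deriv g x = t) :
    EqOn g f U := by
  have hr' : (r : ℂ) ≠ 0 := by exact_mod_cast hr.ne'
  have aux : ∀ {r t : ℝ} {d : ℂ}, 0 < r → 0 < t → (t : ℂ) = d * r → ‖d‖ ≤ 1 → t ≤ r := by
    intro r t d hr ht h hd
    have := congrArg norm h
    rw [norm_mul, Complex.norm_real, Complex.norm_real, Real.norm_of_nonneg hr.le,
      Real.norm_of_nonneg ht.le] at this
    nlinarith
  obtain ⟨h, hhd, hhm, hh0, hhg, hgh⟩ := hf.exists_transition hU hx hfs hg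
  obtain ⟨k, hkd, hkm, hk0, hkf, -⟩ := hg.exists_transition hU hx hgs hf
  rw [hfr, hgt] at hhg hkf
  have hrt : r = t := le_antisymm
    (aux ht hr hkf (Complex.norm_deriv_le_one_of_mapsTo_ball hkd hkm one_pos))
    (aux hr ht hhg (Complex.norm_deriv_le_one_of_mapsTo_ball hhd hhm one_pos))
  have hd1 : deriv h 0 = 1 := by
    rw [← hrt] at hhg
    exact (mul_right_cancel₀ hr' (by rw [← hhg, one_mul]))
  intro z hz
  have := Complex.affine_of_mapsTo_ball_of_norm_dslope_eq_div hhd hhm (mem_ball_self one_pos)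
    (by rw [dslope_same, hd1]; simp) (mem_ball_zero_iff.2 (hf.norm_lt_one z hz))
  rw [hgh z hz, this, dslope_same, hd1, hh0]
  simp

theorem exists_isDiskEmbedding_deriv_pos {U : Set ℂ} (hU : IsOpen U) (hUc : IsSimplyConnected U)
    (hne : U ≠ univ) {x : ℂ} (hx : x ∈ U) :
    ∃ f, IsDiskEmbedding U x f ∧ SurjOn f U (ball 0 1) ∧ ∃ r : ℝ, 0 < r ∧ deriv f x = r := by
  obtain ⟨f, hf, hfs⟩ := exists_isDiskEmbedding_surjOn hU hUc hne hx
  have hd := deriv_ne_zero_of_injOn hU hf.differentiableOn hf.injOn hx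
  have hdn : 0 < ‖deriv f x‖ := norm_pos_iff.2 hd
  have hdn' : (‖deriv f x‖ : ℂ) ≠ 0 := by exact_mod_cast hdn.ne'
  obtain ⟨c, hc, hcd⟩ : ∃ c : ℂ, ‖c‖ = 1 ∧ c * deriv f x = ‖deriv f x‖ := by
    refine ⟨‖deriv f x‖ / deriv f x, ?_, by field_simp⟩
    rw [norm_div, Complex.norm_real, norm_norm, div_self hdn.ne']
  have hc0 : c ≠ 0 := norm_ne_zero_iff.1 (by rw [hc]; exact one_ne_zero)
  refine ⟨fun z ↦ c * f z, ⟨hf.differentiableOn.const_mul c,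
    fun z hz w hw h ↦ hf.injOn hz hw (mul_left_cancel₀ hc0 h),
    fun z hz ↦ by simpa [hc] using hf.norm_lt_one z hz, by simp [hf.map_base]⟩, fun w hw ↦ ?_,
    ‖deriv f x‖, hdn, ?_⟩
  · obtain ⟨z, hz, h⟩ := hfs (show c⁻¹ * w ∈ ball 0 1 by simpa [hc] using hw)
    exact ⟨z, hz, by simp [h, hc0]⟩
  · rw [deriv_const_mul _ (hf.differentiableOn.differentiableAt (hU.mem_nhds hx)), hcd]

/-- The Riemann map of a domain symmetric about the real axis commutes with conjugation. -/
theorem exists_isDiskEmbedding_conj {U : Set ℂ} (hU : IsOpen U) (hUc : IsSimplyConnected U)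
    (hne : U ≠ univ) (hsymm : ∀ z ∈ U, starRingEnd ℂ z ∈ U) {x : ℝ} (hx : (x : ℂ) ∈ U) :
    ∃ f, IsDiskEmbedding U x f ∧ SurjOn f U (ball 0 1) ∧ (∃ r : ℝ, 0 < r ∧ deriv f x = r) ∧
      ∀ z ∈ U, f (starRingEnd ℂ z) = starRingEnd ℂ (f z) := by
  obtain ⟨f, hf, hfs, r, hr, hfr⟩ := exists_isDiskEmbedding_deriv_pos hU hUc hne hx
  refine ⟨f, hf, hfs, ⟨r, hr, hfr⟩, ?_⟩
  set g : ℂ → ℂ := starRingEnd ℂ ∘ f ∘ starRingEnd ℂ with hg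
  have hgd : ∀ z ∈ U, HasDerivAt g (starRingEnd ℂ (deriv f (starRingEnd ℂ z))) z := by
    intro z hz
    have := (hf.differentiableOn.differentiableAt
      (hU.mem_nhds (hsymm z hz))).hasDerivAt.conj_conj
    rwa [Complex.conj_conj] at this
  have hge : IsDiskEmbedding U x g := by
    refine ⟨fun z hz ↦ (hgd z hz).differentiableAt.differentiableWithinAt, fun z hz w hw h ↦ ?_,
      fun z hz ↦ ?_, ?_⟩
    · exact (starRingEnd ℂ).injective (hf.injOn (hsymm z hz) (hsymm w hw)
        ((starRingEnd ℂ).injective h))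
    · simpa [hg] using hf.norm_lt_one _ (hsymm z hz)
    · simp [hg, hf.map_base]
  have hgs : SurjOn g U (ball 0 1) := by
    intro w hw
    obtain ⟨z, hz, h⟩ := hfs (show starRingEnd ℂ w ∈ ball 0 1 by simpa using hw)
    exact ⟨starRingEnd ℂ z, hsymm z hz, by simp [hg, h]⟩
  have heq := hf.eqOn hU hx hfs hge hgs hr hr hfr
    (by rw [(hgd x hx).deriv, Complex.conj_ofReal, hfr, Complex.conj_ofReal])
  intro z hz
  rw [← heq hz]
  simp [hg]

theorem quaternion_sq_eq_neg_one_iff {I : Quaternion ℝ} : I ^ 2 = -1 ↔ I.re = 0 ∧ ‖I‖ = 1 := by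
  constructor
  · intro h
    have hn : ‖I‖ = 1 := by
      have := congrArg norm h
      rw [norm_pow, norm_neg, norm_one] at this
      exact (pow_eq_one_iff_of_nonneg (norm_nonneg _) two_ne_zero).1 this
    refine ⟨?_, hn⟩
    have h2 : Quaternion.normSq I = 1 := by rw [Quaternion.normSq_eq_norm_mul_self, hn, one_mul]
    rw [← Quaternion.sq_eq_neg_normSq, h, h2]
    simp
  · rintro ⟨hre, hn⟩
    rw [Quaternion.sq_eq_neg_normSq.2 hre, Quaternion.normSq_eq_norm_mul_self, hn]
    simp

/-- The map `x + i y ↦ x + I y` from the complex plane onto the slice `ℂ_I`. -/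
def toSlice (I : Quaternion ℝ) : ℂ →L[ℝ] Quaternion ℝ :=
  Complex.reCLM.smulRight 1 + Complex.imCLM.smulRight I

theorem toSlice_apply (I : Quaternion ℝ) (z : ℂ) :
    toSlice I z = (z.re : Quaternion ℝ) + z.im • I := by
  simp [toSlice, ← Quaternion.coe_mul_eq_smul]

theorem toSlice_ofReal (I : Quaternion ℝ) (x : ℝ) : toSlice I x = (x : Quaternion ℝ) := by
  simp [toSlice_apply]

theorem toSlice_neg (I : Quaternion ℝ) (z : ℂ) :
    toSlice (-I) z = toSlice I (starRingEnd ℂ z) := by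
  simp [toSlice_apply]

theorem toSlice_mem_slicePlane (I : Quaternion ℝ) (z : ℂ) : toSlice I z ∈ slicePlane I :=
  ⟨z.re, z.im, toSlice_apply I z⟩

theorem exists_toSlice_eq {I q : Quaternion ℝ} (h : q ∈ slicePlane I) : ∃ z, toSlice I z = q := by
  obtain ⟨x, y, rfl⟩ := h
  exact ⟨⟨x, y⟩, toSlice_apply I _⟩

theorem mul_toSlice {I : Quaternion ℝ} (hI : I ^ 2 = -1) (z : ℂ) :
    I * toSlice I z = toSlice I (Complex.I * z) := by
  simp only [toSlice_apply, mul_add, mul_smul_comm, ← sq, hI, Complex.mul_re, Complex.mul_im,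
    Complex.I_re, Complex.I_im]
  rw [← Quaternion.coe_commutes, Quaternion.coe_mul_eq_smul]
  rw [smul_neg, ← Quaternion.coe_mul_eq_smul z.im, mul_one]
  simp [add_comm]

theorem norm_toSlice {I : Quaternion ℝ} (hI : I ^ 2 = -1) (z : ℂ) : ‖toSlice I z‖ = ‖z‖ := by
  obtain ⟨hre, hn⟩ := quaternion_sq_eq_neg_one_iff.1 hI
  have h2 : Quaternion.normSq I = 1 := by rw [Quaternion.normSq_eq_norm_mul_self, hn, one_mul]
  rw [Quaternion.normSq_def', hre] at h2
  rw [← sq_eq_sq₀ (norm_nonneg _) (norm_nonneg _), sq ‖toSlice I z‖,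
    ← Quaternion.normSq_eq_norm_mul_self, ← Complex.normSq_eq_norm_sq, Quaternion.normSq_def',
    Complex.normSq_apply, toSlice_apply]
  simp [hre]
  linear_combination z.im ^ 2 * h2

theorem toSlice_injective {I : Quaternion ℝ} (hI : I ^ 2 = -1) :
    Function.Injective (toSlice I) := by
  intro z w h
  rw [← sub_eq_zero, ← map_sub, ← norm_eq_zero, norm_toSlice hI, norm_eq_zero] at h
  exact sub_eq_zero.1 h

theorem isEmbedding_toSlice {I : Quaternion ℝ} (hI : I ^ 2 = -1) :
    Topology.IsEmbedding (toSlice I) :=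
  (AddMonoidHomClass.isometry_of_norm (toSlice I) (norm_toSlice hI)).isEmbedding

/-- The real linear projection of the quaternions onto the slice `ℂ_I`, in complex coordinates. -/
def ofSlice (I : Quaternion ℝ) : Quaternion ℝ →L[ℝ] ℂ :=
  (innerSL ℝ (1 : Quaternion ℝ)).smulRight 1 + (innerSL ℝ I).smulRight Complex.I

theorem ofSlice_apply (I q : Quaternion ℝ) : ofSlice I q = ⟨q.re, inner ℝ I q⟩ := by
  apply Complex.ext <;> simp [ofSlice, Quaternion.inner_def]

theorem ofSlice_toSlice {I : Quaternion ℝ} (hI : I ^ 2 = -1) (z : ℂ) :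
    ofSlice I (toSlice I z) = z := by
  obtain ⟨hre, hn⟩ := quaternion_sq_eq_neg_one_iff.1 hI
  rw [ofSlice_apply, toSlice_apply, inner_add_right, inner_smul_right, real_inner_self_eq_norm_sq,
    hn]
  apply Complex.ext <;> simp [hre, Quaternion.inner_def]

theorem toSlice_ofSlice {I q : Quaternion ℝ} (hI : I ^ 2 = -1) (hq : q ∈ slicePlane I) :
    toSlice I (ofSlice I q) = q := by
  obtain ⟨z, rfl⟩ := exists_toSlice_eq hq
  rw [ofSlice_toSlice hI]

theorem ofSlice_mul {I : Quaternion ℝ} (hI : I ^ 2 = -1) (q : Quaternion ℝ) :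
    ofSlice I (I * q) = Complex.I * ofSlice I q := by
  obtain ⟨hre, hn⟩ := quaternion_sq_eq_neg_one_iff.1 hI
  have h2 : Quaternion.normSq I = 1 := by rw [Quaternion.normSq_eq_norm_mul_self, hn, one_mul]
  rw [Quaternion.normSq_def', hre] at h2
  apply Complex.ext
  · simp [ofSlice_apply, Quaternion.inner_def, hre]; ring
  · simp [ofSlice_apply, Quaternion.inner_def, hre]
    linear_combination q.re * h2

theorem toSlice_eq_toSlice {I J : Quaternion ℝ} (hI : I ^ 2 = -1) (hJ : J ^ 2 = -1) {a b : ℂ}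
    (h : toSlice I a = toSlice J b) :
    (a = b ∧ (a.im = 0 ∨ I = J)) ∨ (b = starRingEnd ℂ a ∧ J = -I) := by
  obtain ⟨hIre, hIn⟩ := quaternion_sq_eq_neg_one_iff.1 hI
  obtain ⟨hJre, hJn⟩ := quaternion_sq_eq_neg_one_iff.1 hJ
  rw [toSlice_apply, toSlice_apply] at h
  have hre : a.re = b.re := by
    simpa [hIre, hJre] using congrArg QuaternionAlgebra.re h
  rw [hre, add_right_inj] at h
  have hab : |a.im| = |b.im| := by
    simpa [norm_smul, hIn, hJn] using congrArg norm h
  by_cases ha : a.im = 0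
  · left
    rw [ha, abs_zero, eq_comm, abs_eq_zero] at hab
    exact ⟨Complex.ext hre (by rw [ha, hab]), Or.inl ha⟩
  rcases abs_eq_abs.1 hab with h1 | h1
  · left
    rw [← h1] at h
    exact ⟨Complex.ext hre h1, Or.inr (smul_right_injective _ ha h)⟩
  · right
    rw [h1, neg_smul, ← smul_neg] at h
    have hb : b.im ≠ 0 := fun hb ↦ ha (by rw [h1, hb, neg_zero])
    refine ⟨Complex.ext (by simp [hre]) (by simp [h1]), ?_⟩
    rw [← smul_right_injective _ hb h]

/-- The complex coordinate of a quaternion in the upper half of its slice. -/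
def sliceCoord (q : Quaternion ℝ) : ℂ := ⟨q.re, ‖q.im‖⟩

theorem exists_imaginary_unit : ∃ I : Quaternion ℝ, I ^ 2 = -1 := by
  let I : Quaternion ℝ := ⟨0, 1, 0, 0⟩
  refine ⟨I, quaternion_sq_eq_neg_one_iff.2 ⟨rfl, ?_⟩⟩
  rw [← sq_eq_sq₀ (norm_nonneg _) zero_le_one, sq, ← Quaternion.normSq_eq_norm_mul_self,
    Quaternion.normSq_def']
  simp [I]

theorem exists_toSlice_sliceCoord (q : Quaternion ℝ) :
    ∃ I : Quaternion ℝ, I ^ 2 = -1 ∧ toSlice I (sliceCoord q) = q := by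
  by_cases h : q.im = 0
  · obtain ⟨I, hI⟩ := exists_imaginary_unit
    refine ⟨I, hI, ?_⟩
    rw [toSlice_apply, sliceCoord, h, norm_zero, zero_smul, add_zero]
    conv_rhs => rw [← Quaternion.re_add_im q, h, add_zero]
  · have hn : ‖q.im‖ ≠ 0 := norm_ne_zero_iff.2 h
    refine ⟨‖q.im‖⁻¹ • q.im, quaternion_sq_eq_neg_one_iff.2 ⟨by simp, ?_⟩, ?_⟩
    · rw [norm_smul, norm_inv, norm_norm, inv_mul_cancel₀ hn]
    · rw [toSlice_apply, sliceCoord, smul_smul, mul_inv_cancel₀ hn, one_smul,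
        Quaternion.re_add_im]

theorem continuous_sliceCoord : Continuous sliceCoord := by
  have : sliceCoord = fun q ↦ (q.re : ℂ) + ‖q.im‖ * Complex.I := by
    funext q; apply Complex.ext <;> simp [sliceCoord]
  rw [this]
  have h1 := Quaternion.continuous_re
  have h2 := Quaternion.continuous_im
  fun_prop

theorem sliceCoord_coe (x : ℝ) : sliceCoord (x : Quaternion ℝ) = x := by
  apply Complex.ext <;> simp [sliceCoord]

/-- The complex coordinates of a set of quaternions. -/
def sliceDomain (Ω : Set (Quaternion ℝ)) : Set ℂ :=
  {z | ∃ I : Quaternion ℝ, I ^ 2 = -1 ∧ toSlice I z ∈ Ω}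

theorem AxiallySymmetric.mem_sliceDomain {Ω : Set (Quaternion ℝ)} (hΩ : AxiallySymmetric Ω)
    {I : Quaternion ℝ} (hI : I ^ 2 = -1) {z : ℂ} : z ∈ sliceDomain Ω ↔ toSlice I z ∈ Ω := by
  refine ⟨fun ⟨J, hJ, h⟩ ↦ ?_, fun h ↦ ⟨I, hI, h⟩⟩
  rw [toSlice_apply] at *
  exact hΩ _ _ J I hJ hI h

theorem AxiallySymmetric.conj_mem_sliceDomain {Ω : Set (Quaternion ℝ)} (hΩ : AxiallySymmetric Ω)
    {z : ℂ} (hz : z ∈ sliceDomain Ω) : starRingEnd ℂ z ∈ sliceDomain Ω := by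
  obtain ⟨I, hI⟩ := exists_imaginary_unit
  rw [hΩ.mem_sliceDomain hI, ← toSlice_neg, ← hΩ.mem_sliceDomain (by rw [neg_sq, hI])]
  exact hz

theorem AxiallySymmetric.isOpen_sliceDomain {Ω : Set (Quaternion ℝ)} (hΩ : AxiallySymmetric Ω)
    (ho : IsOpen Ω) : IsOpen (sliceDomain Ω) := by
  obtain ⟨I, hI⟩ := exists_imaginary_unit
  have : sliceDomain Ω = toSlice I ⁻¹' Ω := by ext z; exact hΩ.mem_sliceDomain hI
  rw [this]
  exact ho.preimage (toSlice I).continuous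

theorem MemFrakR.isSimplyConnected_sliceDomain {Ω : Set (Quaternion ℝ)} (hΩ : MemFrakR Ω) :
    IsSimplyConnected (sliceDomain Ω) := by
  obtain ⟨I, hI⟩ := exists_imaginary_unit
  rw [← (isEmbedding_toSlice hI).isSimplyConnected_image]
  have : toSlice I '' sliceDomain Ω = Ω ∩ slicePlane I := by
    ext q
    constructor
    · rintro ⟨z, hz, rfl⟩
      exact ⟨(hΩ.2.1.mem_sliceDomain hI).1 hz, toSlice_mem_slicePlane I z⟩
    · rintro ⟨hq, hqI⟩
      obtain ⟨z, rfl⟩ := exists_toSlice_eq hqI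
      exact ⟨z, (hΩ.2.1.mem_sliceDomain hI).2 hq, rfl⟩
  rw [this]
  exact hΩ.2.2 I hI

theorem norm_sliceCoord_sub_ofReal (q : Quaternion ℝ) (x : ℝ) :
    ‖sliceCoord q - x‖ = ‖q - (x : Quaternion ℝ)‖ := by
  obtain ⟨I, hI, h⟩ := exists_toSlice_sliceCoord q
  conv_rhs => rw [← h]
  rw [← toSlice_ofReal I, ← map_sub, norm_toSlice hI]

/-- The quaternionic intrinsic function induced by a complex function that commutes with
conjugation. -/
def intrinsicExtension (F : ℂ → ℂ) (q : Quaternion ℝ) : Quaternion ℝ :=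
  ((F (sliceCoord q)).re : Quaternion ℝ) + ((F (sliceCoord q)).im / ‖q.im‖) • q.im

section Extension

variable {D : Set ℂ} {F : ℂ → ℂ}

theorem im_eq_zero_of_conj_eq (hF : ∀ z ∈ D, F (starRingEnd ℂ z) = starRingEnd ℂ (F z))
    {z : ℂ} (hz : z ∈ D) (h : z.im = 0) : (F z).im = 0 := by
  have h1 := hF z hz
  rw [Complex.conj_eq_iff_im.2 h, eq_comm, Complex.conj_eq_iff_im] at h1
  exact h1

theorem intrinsicExtension_toSlice (hF : ∀ z ∈ D, F (starRingEnd ℂ z) = starRingEnd ℂ (F z))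
    {I : Quaternion ℝ} (hI : I ^ 2 = -1) {z : ℂ} (hz : z ∈ D) :
    intrinsicExtension F (toSlice I z) = toSlice I (F z) := by
  obtain ⟨hIre, hIn⟩ := quaternion_sq_eq_neg_one_iff.1 hI
  have him : (toSlice I z).im = z.im • I := by
    rw [toSlice_apply]; ext <;> simp [hIre]
  have hre : (toSlice I z).re = z.re := by simp [toSlice_apply, hIre]
  have hn : ‖(toSlice I z).im‖ = |z.im| := by rw [him, norm_smul, hIn, mul_one, Real.norm_eq_abs]
  rw [intrinsicExtension, sliceCoord, hn, hre, him, toSlice_apply, smul_smul]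
  rcases lt_trichotomy z.im 0 with h | h | h
  · have hc : (⟨z.re, |z.im|⟩ : ℂ) = starRingEnd ℂ z :=
      Complex.ext (by simp) (by simp [abs_of_neg h])
    rw [hc, hF z hz, abs_of_neg h]
    congr 2
    simp [h.ne]
  · rw [h, mul_zero, abs_zero, im_eq_zero_of_conj_eq hF hz h]
    congr 3
    exact congrArg F (Complex.ext rfl h.symm)
  · rw [abs_of_pos h, div_mul_cancel₀ _ h.ne']

theorem hasDerivAt_ofReal (hF : ∀ z ∈ D, F (starRingEnd ℂ z) = starRingEnd ℂ (F z)) {x : ℝ}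
    (hD : IsOpen D) (hx : (x : ℂ) ∈ D) (hd : DifferentiableAt ℂ F x) :
    ∃ c : ℝ, HasDerivAt F c x := by
  have h := hd.hasDerivAt.conj_conj
  rw [Complex.conj_ofReal] at h
  have he : (starRingEnd ℂ ∘ F ∘ starRingEnd ℂ) =ᶠ[𝓝 (x : ℂ)] F := by
    filter_upwards [hD.mem_nhds hx] with z hz
    simp [hF z hz]
  have hc := (h.congr_of_eventuallyEq he.symm).unique hd.hasDerivAt
  obtain ⟨c, hc⟩ := Complex.conj_eq_iff_real.1 hc
  exact ⟨c, hc ▸ hd.hasDerivAt⟩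

theorem hasFDerivAt_intrinsicExtension_ofReal
    (hF : ∀ z ∈ D, F (starRingEnd ℂ z) = starRingEnd ℂ (F z)) {x c : ℝ}
    (hD : IsOpen D) (hx : (x : ℂ) ∈ D) (hd : HasDerivAt F c x) :
    HasFDerivAt (intrinsicExtension F) (c • ContinuousLinearMap.id ℝ (Quaternion ℝ))
      (x : Quaternion ℝ) := by
  have ht : Tendsto sliceCoord (𝓝 (x : Quaternion ℝ)) (𝓝 (x : ℂ)) := by
    simpa [sliceCoord_coe] using continuous_sliceCoord.tendsto (x : Quaternion ℝ)
  have ho := (hasDerivAt_iff_isLittleO.1 hd).comp_tendsto ht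
  rw [hasFDerivAt_iff_isLittleO]
  refine (ho.norm_norm.congr' ?_ ?_).of_norm_norm
  · filter_upwards [ht.eventually (hD.mem_nhds hx)] with q hq
    obtain ⟨I, hI, h⟩ := exists_toSlice_sliceCoord q
    have hz := intrinsicExtension_toSlice hF hI hq
    rw [h] at hz
    rw [hz, ← toSlice_ofReal I x, intrinsicExtension_toSlice hF hI hx]
    nth_rw 3 [← h]
    rw [smul_apply, ContinuousLinearMap.id_apply, ← map_sub, ← map_sub,
      ← map_smul, ← map_sub, norm_toSlice hI]
    simp [mul_comm]
  · filter_upwards with q using norm_sliceCoord_sub_ofReal q x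

theorem differentiableAt_intrinsicExtension {q : Quaternion ℝ} (hq : q.im ≠ 0)
    (hd : DifferentiableAt ℂ F (sliceCoord q)) :
    DifferentiableAt ℝ (intrinsicExtension F) q := by
  have hre : Differentiable ℝ (fun q : Quaternion ℝ ↦ q.re) := by
    have : (fun q : Quaternion ℝ ↦ q.re) = innerSL ℝ (1 : Quaternion ℝ) := by
      funext q; simp [Quaternion.inner_def]
    rw [this]
    exact (innerSL ℝ (1 : Quaternion ℝ)).differentiable
  have hcoe : Differentiable ℝ (fun x : ℝ ↦ (x : Quaternion ℝ)) :=
    (Algebra.linearMap ℝ (Quaternion ℝ)).toContinuousLinearMap.differentiable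
  have him : Differentiable ℝ (fun q : Quaternion ℝ ↦ q.im) := by
    have : (fun q : Quaternion ℝ ↦ q.im) = fun q ↦ q - (q.re : Quaternion ℝ) := by
      funext q; rw [eq_sub_iff_add_eq, add_comm, Quaternion.re_add_im]
    rw [this]
    exact differentiable_id.sub (hcoe.comp hre)
  have hn : DifferentiableAt ℝ (fun q : Quaternion ℝ ↦ ‖q.im‖) q := (him q).norm ℝ hq
  have hs : DifferentiableAt ℝ sliceCoord q :=
    Complex.equivRealProdCLM.symm.differentiableAt.comp q ((hre q).prodMk hn)
  have hFs : DifferentiableAt ℝ (fun q ↦ F (sliceCoord q)) q := (hd.restrictScalars ℝ).comp q hs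
  have hFre : DifferentiableAt ℝ (fun q ↦ (F (sliceCoord q)).re) q :=
    Complex.reCLM.differentiableAt.comp q hFs
  have hFim : DifferentiableAt ℝ (fun q ↦ (F (sliceCoord q)).im) q :=
    Complex.imCLM.differentiableAt.comp q hFs
  have hdiv : DifferentiableAt ℝ (fun q ↦ (F (sliceCoord q)).im / ‖q.im‖) q :=
    hFim.fun_mul (hn.fun_inv (norm_ne_zero_iff.2 hq))
  exact ((hcoe _).comp q hFre).add (hdiv.smul (him q))

theorem hasFDerivAt_intrinsicExtension_slice (hD : IsOpen D)
    (hF : ∀ z ∈ D, F (starRingEnd ℂ z) = starRingEnd ℂ (F z)) {I : Quaternion ℝ}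
    (hI : I ^ 2 = -1) {x y : ℝ} (hz : (⟨x, y⟩ : ℂ) ∈ D) (hd : DifferentiableAt ℂ F ⟨x, y⟩) :
    HasFDerivAt (fun p : ℝ × ℝ ↦ intrinsicExtension F ((p.1 : Quaternion ℝ) + p.2 • I))
      (toSlice I ∘L ((fderiv ℂ F ⟨x, y⟩).restrictScalars ℝ ∘L
        (Complex.equivRealProdCLM.symm : ℝ × ℝ →L[ℝ] ℂ))) (x, y) := by
  have he : HasFDerivAt Complex.equivRealProdCLM.symm
      (Complex.equivRealProdCLM.symm : ℝ × ℝ →L[ℝ] ℂ) (x, y) :=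
    Complex.equivRealProdCLM.symm.hasFDerivAt
  have h := (toSlice I).hasFDerivAt.comp (x, y)
    (HasFDerivAt.comp (x, y) (f := Complex.equivRealProdCLM.symm)
      (g := F) (hd.hasFDerivAt.restrictScalars ℝ) he)
  refine h.congr_of_eventuallyEq ?_
  filter_upwards [he.continuousAt.eventually (hD.mem_nhds hz)] with p hp
  have := intrinsicExtension_toSlice hF hI hp
  rwa [toSlice_apply] at this

theorem sliceRegularOn_intrinsicExtension {Ω : Set (Quaternion ℝ)} (hΩ : MemFrakR Ω)
    (hd : DifferentiableOn ℂ F (sliceDomain Ω))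
    (hF : ∀ z ∈ sliceDomain Ω, F (starRingEnd ℂ z) = starRingEnd ℂ (F z)) :
    SliceRegularOn (intrinsicExtension F) Ω := by
  have hD := hΩ.2.1.isOpen_sliceDomain hΩ.1
  refine ⟨fun q hq ↦ DifferentiableAt.differentiableWithinAt ?_, fun I hI x y hz ↦ ?_⟩
  · obtain ⟨I, hI, h⟩ := exists_toSlice_sliceCoord q
    have hqD : sliceCoord q ∈ sliceDomain Ω := ⟨I, hI, h.symm ▸ hq⟩
    have hdq := hd.differentiableAt (hD.mem_nhds hqD)
    by_cases him : q.im = 0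
    · have hqr : q = (q.re : Quaternion ℝ) := by
        conv_lhs => rw [← Quaternion.re_add_im q, him, add_zero]
      rw [hqr, sliceCoord_coe] at hqD hdq
      obtain ⟨c, hc⟩ := hasDerivAt_ofReal hF hD hqD hdq
      rw [hqr]
      exact (hasFDerivAt_intrinsicExtension_ofReal hF hD hqD hc).differentiableAt
    · exact differentiableAt_intrinsicExtension him hdq
  · have hzD : (⟨x, y⟩ : ℂ) ∈ sliceDomain Ω := ⟨I, hI, by rwa [toSlice_apply]⟩
    rw [(hasFDerivAt_intrinsicExtension_slice hD hF hI hzD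
      (hd.differentiableAt (hD.mem_nhds hzD))).fderiv]
    have h1 : Complex.equivRealProdCLM.symm (1, 0) = 1 := rfl
    have h2 : Complex.equivRealProdCLM.symm (0, 1) = Complex.I • 1 := by
      rw [smul_eq_mul, mul_one]; rfl
    simp only [ContinuousLinearMap.comp_apply, ContinuousLinearEquiv.coe_coe, h1, h2,
      ContinuousLinearMap.coe_restrictScalars', map_smul, mul_toSlice hI]
    rw [← map_add, smul_eq_mul, ← mul_assoc, Complex.I_mul_I, neg_one_mul, add_neg_cancel, map_zero]

end Extension

/-- The restriction of a quaternionic function to the slice `ℂ_I`, in complex coordinates. -/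
def sliceRestriction (I : Quaternion ℝ) (g : Quaternion ℝ → Quaternion ℝ) (z : ℂ) : ℂ :=
  ofSlice I (g (toSlice I z))

section Restriction

variable {Ω : Set (Quaternion ℝ)} {g : Quaternion ℝ → Quaternion ℝ}

theorem SliceRegularOn.hasDerivAt_sliceRestriction (hg : SliceRegularOn g Ω) (hΩ : MemFrakR Ω)
    {I : Quaternion ℝ} (hI : I ^ 2 = -1) {z : ℂ} (hz : z ∈ sliceDomain Ω) :
    HasDerivAt (sliceRestriction I g) (ofSlice I (fderiv ℝ g (toSlice I z) 1)) z := by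
  have hq := (hΩ.2.1.mem_sliceDomain hI).1 hz
  have hd := (hg.1.differentiableAt (hΩ.1.mem_nhds hq)).hasFDerivAt
  have hs : HasFDerivAt (fun w ↦ g (toSlice I w)) (fderiv ℝ g (toSlice I z) ∘L toSlice I) z :=
    hd.comp z (toSlice I).hasFDerivAt
  have hp : HasFDerivAt (fun p : ℝ × ℝ ↦ g ((p.1 : Quaternion ℝ) + p.2 • I))
      ((fderiv ℝ g (toSlice I z) ∘L toSlice I) ∘L
        (Complex.equivRealProdCLM.symm : ℝ × ℝ →L[ℝ] ℂ)) (z.re, z.im) := by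
    refine (HasFDerivAt.comp (z.re, z.im) (f := Complex.equivRealProdCLM.symm)
      (g := fun w ↦ g (toSlice I w)) hs
      Complex.equivRealProdCLM.symm.hasFDerivAt).congr_of_eventuallyEq (.of_forall fun p ↦ ?_)
    exact congrArg g (toSlice_apply I (Complex.equivRealProdCLM.symm p)).symm
  have hcr := hg.2 I hI z.re z.im (by rwa [← toSlice_apply])
  have hr : HasFDerivAt (sliceRestriction I g)
      (ofSlice I ∘L (fderiv ℝ g (toSlice I z) ∘L toSlice I)) z :=
    (ofSlice I).hasFDerivAt.comp z hs
  have h1 : Complex.equivRealProdCLM.symm (1, 0) = 1 := rfl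
  have h2 : Complex.equivRealProdCLM.symm (0, 1) = Complex.I := rfl
  have h3 : toSlice I 1 = 1 := by simp [toSlice_apply]
  rw [hp.fderiv] at hcr
  simp only [ContinuousLinearMap.comp_apply, ContinuousLinearEquiv.coe_coe, h1, h2, h3] at hcr
  have hcr' := congrArg (ofSlice I) hcr
  rw [map_add, ofSlice_mul hI, map_zero] at hcr'
  have hdz : DifferentiableAt ℂ (sliceRestriction I g) z := by
    refine differentiableAt_complex_iff_differentiableAt_real.2 ⟨hr.differentiableAt, ?_⟩
    rw [hr.fderiv]
    simp only [ContinuousLinearMap.comp_apply, h3, smul_eq_mul]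
    linear_combination (-Complex.I) * hcr' +
      ofSlice I (fderiv ℝ g (toSlice I z) (toSlice I Complex.I)) * Complex.I_sq
  have h4 := congrArg (fun A ↦ A 1) ((hdz.hasFDerivAt.restrictScalars ℝ).unique hr)
  simp only [ContinuousLinearMap.coe_restrictScalars', fderiv_apply_one_eq_deriv,
    ContinuousLinearMap.comp_apply, h3] at h4
  exact h4 ▸ hdz.hasDerivAt

theorem QIntrinsicOn.toSlice_sliceRestriction (hg : QIntrinsicOn g Ω) (hΩ : MemFrakR Ω)
    {I : Quaternion ℝ} (hI : I ^ 2 = -1) {z : ℂ} (hz : z ∈ sliceDomain Ω) :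
    toSlice I (sliceRestriction I g z) = g (toSlice I z) :=
  toSlice_ofSlice hI
    (hg.2 I hI _ ⟨(hΩ.2.1.mem_sliceDomain hI).1 hz, toSlice_mem_slicePlane I z⟩)

theorem eq_re_of_forall_mem_slicePlane {q : Quaternion ℝ}
    (h : ∀ I : Quaternion ℝ, I ^ 2 = -1 → q ∈ slicePlane I) : q = (q.re : Quaternion ℝ) := by
  let I : Quaternion ℝ := ⟨0, 1, 0, 0⟩
  let J : Quaternion ℝ := ⟨0, 0, 1, 0⟩
  have hI : I ^ 2 = -1 := by
    rw [Quaternion.sq_eq_neg_normSq.2 rfl, Quaternion.normSq_def']; simp [I]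
  have hJ : J ^ 2 = -1 := by
    rw [Quaternion.sq_eq_neg_normSq.2 rfl, Quaternion.normSq_def']; simp [J]
  have hIJ : I.imJ = 0 := rfl
  have hIK : I.imK = 0 := rfl
  have hJI : J.imI = 0 := rfl
  obtain ⟨x, y, hx⟩ := h I hI
  obtain ⟨u, v, hu⟩ := h J hJ
  have h1 : q.imI = 0 := by rw [hu]; simp [hJI]
  have h2 : q.imJ = 0 := by rw [hx]; simp [hIJ]
  have h3 : q.imK = 0 := by rw [hx]; simp [hIK]
  ext <;> simp [h1, h2, h3]

theorem QIntrinsicOn.eqOn_sliceRestriction (hg : QIntrinsicOn g Ω) (hΩ : MemFrakR Ω)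
    {I J : Quaternion ℝ} (hI : I ^ 2 = -1) (hJ : J ^ 2 = -1) {x : ℝ}
    (hx : (x : ℂ) ∈ sliceDomain Ω) :
    EqOn (sliceRestriction I g) (sliceRestriction J g) (sliceDomain Ω) := by
  have hD := hΩ.2.1.isOpen_sliceDomain hΩ.1
  have hdiff {K : Quaternion ℝ} (hK : K ^ 2 = -1) :
      AnalyticOnNhd ℂ (sliceRestriction K g) (sliceDomain Ω) :=
    DifferentiableOn.analyticOnNhd (fun z hz ↦
      (hg.1.hasDerivAt_sliceRestriction hΩ hK hz).differentiableAt.differentiableWithinAt) hD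
  refine (hdiff hI).eqOn_of_preconnected_of_frequently_eq (hdiff hJ)
    hΩ.isSimplyConnected_sliceDomain.isPathConnected.isConnected.isPreconnected hx ?_
  have ht : Tendsto (fun t : ℝ ↦ (t : ℂ)) (𝓝[≠] x) (𝓝[≠] (x : ℂ)) :=
    Complex.continuous_ofReal.continuousAt.continuousWithinAt.tendsto_nhdsWithin fun t ht ↦ by
      simpa using ht
  refine ht.frequently (Eventually.frequently ?_)
  filter_upwards [(ht.mono_right nhdsWithin_le_nhds).eventually (hD.mem_nhds hx)] with t hmem
  have hreal : g (t : Quaternion ℝ) = ((g (t : Quaternion ℝ)).re : Quaternion ℝ) := by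
    refine eq_re_of_forall_mem_slicePlane fun K hK ↦ ?_
    rw [← toSlice_ofReal K, ← hg.toSlice_sliceRestriction hΩ hK hmem]
    exact toSlice_mem_slicePlane K _
  have hres {K : Quaternion ℝ} (hK : K ^ 2 = -1) :
      sliceRestriction K g t = ((g (t : Quaternion ℝ)).re : ℂ) := by
    rw [sliceRestriction, toSlice_ofReal, hreal, ← toSlice_ofReal K, ofSlice_toSlice hK,
      toSlice_ofReal, Quaternion.re_coe]
  rw [hres hI, hres hJ]

variable {G : ℂ → ℂ}

theorem bijOn_of_toSlice (hΩ : AxiallySymmetric Ω) (hinj : InjOn G (sliceDomain Ω))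
    (hmaps : MapsTo G (sliceDomain Ω) (ball 0 1)) (hsurj : SurjOn G (sliceDomain Ω) (ball 0 1))
    (hG : ∀ I : Quaternion ℝ, I ^ 2 = -1 → ∀ z ∈ sliceDomain Ω,
      g (toSlice I z) = toSlice I (G z))
    (hconj : ∀ z ∈ sliceDomain Ω, G (starRingEnd ℂ z) = starRingEnd ℂ (G z)) :
    BijOn g Ω (ball 0 1) := by
  refine ⟨fun q hq ↦ ?_, fun p hp q hq hpq ↦ ?_, fun p hp ↦ ?_⟩
  · obtain ⟨I, hI, h⟩ := exists_toSlice_sliceCoord q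
    have hz : sliceCoord q ∈ sliceDomain Ω := ⟨I, hI, h.symm ▸ hq⟩
    rw [← h, hG I hI _ hz, mem_ball_zero_iff, norm_toSlice hI]
    exact mem_ball_zero_iff.1 (hmaps hz)
  · obtain ⟨I, hI, h⟩ := exists_toSlice_sliceCoord p
    obtain ⟨J, hJ, h'⟩ := exists_toSlice_sliceCoord q
    have hz : sliceCoord p ∈ sliceDomain Ω := ⟨I, hI, h.symm ▸ hp⟩
    have hw : sliceCoord q ∈ sliceDomain Ω := ⟨J, hJ, h'.symm ▸ hq⟩
    rw [← h, ← h', hG I hI _ hz, hG J hJ _ hw] at hpq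
    have hz' := hΩ.conj_mem_sliceDomain hz
    rw [← h, ← h']
    rcases toSlice_eq_toSlice hI hJ hpq with ⟨heq, him | rfl⟩ | ⟨heq, rfl⟩
    · rw [← Complex.conj_eq_iff_im, ← hconj _ hz] at him
      have hr := Complex.conj_eq_iff_im.1 (hinj hz' hz him)
      rw [← hinj hz hw heq, toSlice_apply, toSlice_apply, hr, zero_smul, zero_smul]
    · rw [hinj hz hw heq]
    · rw [toSlice_neg, hinj hw hz' (heq.trans (hconj _ hz).symm), Complex.conj_conj]
  · obtain ⟨I, hI, h⟩ := exists_toSlice_sliceCoord p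
    rw [← h, mem_ball_zero_iff, norm_toSlice hI, ← mem_ball_zero_iff] at hp
    obtain ⟨z, hz, hzp⟩ := hsurj hp
    exact ⟨toSlice I z, (hΩ.mem_sliceDomain hI).1 hz, by rw [hG I hI z hz, hzp, h]⟩

theorem surjOn_of_toSlice (hΩ : AxiallySymmetric Ω) (hsurj : SurjOn g Ω (ball 0 1))
    (hG : ∀ I : Quaternion ℝ, I ^ 2 = -1 → ∀ z ∈ sliceDomain Ω,
      g (toSlice I z) = toSlice I (G z)) :
    SurjOn G (sliceDomain Ω) (ball 0 1) := by
  intro w hw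
  obtain ⟨I, hI⟩ := exists_imaginary_unit
  obtain ⟨q, hq, hqw⟩ := hsurj (show toSlice I w ∈ ball 0 1 by
    rwa [mem_ball_zero_iff, norm_toSlice hI, ← mem_ball_zero_iff])
  obtain ⟨J, hJ, h⟩ := exists_toSlice_sliceCoord q
  have hz : sliceCoord q ∈ sliceDomain Ω := ⟨J, hJ, h.symm ▸ hq⟩
  rw [← h, hG J hJ _ hz] at hqw
  rcases toSlice_eq_toSlice hI hJ hqw.symm with ⟨heq, -⟩ | ⟨-, rfl⟩
  · exact ⟨_, hz, heq.symm⟩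
  · refine ⟨_, hΩ.conj_mem_sliceDomain hz, toSlice_injective hI ?_⟩
    rw [← hG I hI _ (hΩ.conj_mem_sliceDomain hz), ← toSlice_neg, hG _ hJ _ hz, hqw]

theorem QIntrinsicOn.exists_isDiskEmbedding (hg : QIntrinsicOn g Ω) (hΩ : MemFrakR Ω)
    (hb : BijOn g Ω (ball 0 1)) {x : ℝ} (hx : (x : ℂ) ∈ sliceDomain Ω)
    (hgx : g (x : Quaternion ℝ) = 0) (hpos : IsPosReal (sliceDeriv g (x : Quaternion ℝ))) :
    ∃ G : ℂ → ℂ, IsDiskEmbedding (sliceDomain Ω) x G ∧ SurjOn G (sliceDomain Ω) (ball 0 1) ∧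
      (∃ r : ℝ, 0 < r ∧ deriv G x = r) ∧
      ∀ I : Quaternion ℝ, I ^ 2 = -1 → ∀ z ∈ sliceDomain Ω,
        g (toSlice I z) = toSlice I (G z) := by
  obtain ⟨I, hI⟩ := exists_imaginary_unit
  have hG : ∀ J : Quaternion ℝ, J ^ 2 = -1 → ∀ z ∈ sliceDomain Ω,
      g (toSlice J z) = toSlice J (sliceRestriction I g z) := fun J hJ z hz ↦ by
    rw [hg.eqOn_sliceRestriction hΩ hI hJ hx hz, hg.toSlice_sliceRestriction hΩ hJ hz]
  refine ⟨sliceRestriction I g, ⟨fun z hz ↦ ?_, fun z hz w hw h ↦ ?_, fun z hz ↦ ?_, ?_⟩,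
    surjOn_of_toSlice hΩ.2.1 hb.surjOn hG, ?_, hG⟩
  · exact (hg.1.hasDerivAt_sliceRestriction hΩ hI hz).differentiableAt.differentiableWithinAt
  · refine toSlice_injective hI (hb.injOn ((hΩ.2.1.mem_sliceDomain hI).1 hz)
      ((hΩ.2.1.mem_sliceDomain hI).1 hw) ?_)
    rw [hG I hI z hz, hG I hI w hw, h]
  · rw [← norm_toSlice hI, ← hG I hI z hz, ← mem_ball_zero_iff]
    exact hb.mapsTo ((hΩ.2.1.mem_sliceDomain hI).1 hz)
  · rw [sliceRestriction, toSlice_ofReal, hgx, map_zero]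
  · obtain ⟨r, hr, hgr⟩ := hpos
    refine ⟨r, hr, ?_⟩
    rw [(hg.1.hasDerivAt_sliceRestriction hΩ hI hx).deriv, toSlice_ofReal, ← sliceDeriv, hgr,
      ← toSlice_ofReal I, ofSlice_toSlice hI]

end Restriction

/-- **Quaternionic Riemann mapping theorem.** Let `Ω ∈ 𝔯(ℍ)` be nonempty with
`Ω ∩ ℂ_I ≠ ℂ_I` for every unit imaginary quaternion `I`, and let `x₀ ∈ Ω ∩ ℝ`. Then
there exists a unique quaternionic intrinsic slice regular `f : Ω → 𝔹` which is
bijective onto the open unit ball `𝔹` and satisfies `f(x₀) = 0`, `f'(x₀) > 0` (slice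
derivative). -/
theorem quaternionic_riemann_mapping
    (Ω : Set (Quaternion ℝ)) (hΩ : MemFrakR Ω) (hne : Ω.Nonempty)
    (hproper : ∀ I : Quaternion ℝ, I ^ 2 = -1 → Ω ∩ slicePlane I ≠ slicePlane I)
    (x₀ : ℝ) (hx₀ : (x₀ : Quaternion ℝ) ∈ Ω) :
    ∃ f : Quaternion ℝ → Quaternion ℝ,
      (QIntrinsicOn f Ω ∧ Set.BijOn f Ω (Metric.ball 0 1) ∧
        f (x₀ : Quaternion ℝ) = 0 ∧ IsPosReal (sliceDeriv f (x₀ : Quaternion ℝ))) ∧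
      ∀ g : Quaternion ℝ → Quaternion ℝ,
        (QIntrinsicOn g Ω ∧ Set.BijOn g Ω (Metric.ball 0 1) ∧
          g (x₀ : Quaternion ℝ) = 0 ∧ IsPosReal (sliceDeriv g (x₀ : Quaternion ℝ))) →
        Set.EqOn g f Ω := by
  have hD := hΩ.2.1.isOpen_sliceDomain hΩ.1
  have hx : (x₀ : ℂ) ∈ sliceDomain Ω := by
    obtain ⟨I, hI⟩ := exists_imaginary_unit
    exact ⟨I, hI, by rwa [toSlice_ofReal]⟩
  have hDne : sliceDomain Ω ≠ univ := by
    intro h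
    obtain ⟨I, hI⟩ := exists_imaginary_unit
    refine hproper I hI (inter_eq_right.2 fun q hq ↦ ?_)
    obtain ⟨z, rfl⟩ := exists_toSlice_eq hq
    exact (hΩ.2.1.mem_sliceDomain hI).1 (h ▸ mem_univ z)
  obtain ⟨F, hF, hFs, ⟨r, hr, hFr⟩, hconj⟩ := exists_isDiskEmbedding_conj hD
    hΩ.isSimplyConnected_sliceDomain hDne (fun z ↦ hΩ.2.1.conj_mem_sliceDomain) hx
  have hext : ∀ I : Quaternion ℝ, I ^ 2 = -1 → ∀ z ∈ sliceDomain Ω,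
      intrinsicExtension F (toSlice I z) = toSlice I (F z) := fun I hI z hz ↦
    intrinsicExtension_toSlice hconj hI hz
  have hFd : HasDerivAt F r x₀ :=
    hFr ▸ (hF.differentiableOn.differentiableAt (hD.mem_nhds hx)).hasDerivAt
  refine ⟨intrinsicExtension F, ⟨⟨sliceRegularOn_intrinsicExtension hΩ hF.differentiableOn hconj,
    fun I hI q hq ↦ ?_⟩, bijOn_of_toSlice hΩ.2.1 hF.injOn
      (fun z hz ↦ mem_ball_zero_iff.2 (hF.norm_lt_one z hz)) hFs hext hconj, ?_, r, hr, ?_⟩,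
    fun g ⟨hg, hgb, hgx, hgd⟩ q hq ↦ ?_⟩
  · obtain ⟨z, rfl⟩ := exists_toSlice_eq hq.2
    rw [hext I hI z ((hΩ.2.1.mem_sliceDomain hI).2 hq.1)]
    exact toSlice_mem_slicePlane I _
  · obtain ⟨I, hI⟩ := exists_imaginary_unit
    rw [← toSlice_ofReal I, hext I hI _ hx, hF.map_base, map_zero]
  · rw [sliceDeriv, (hasFDerivAt_intrinsicExtension_ofReal hconj hD hx hFd).fderiv, smul_apply,
      ContinuousLinearMap.id_apply, ← Quaternion.coe_mul_eq_smul, mul_one]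
  · obtain ⟨G, hG, hGs, ⟨t, ht, hGt⟩, hGext⟩ := hg.exists_isDiskEmbedding hΩ hgb hx hgx hgd
    obtain ⟨I, hI, h⟩ := exists_toSlice_sliceCoord q
    have hz : sliceCoord q ∈ sliceDomain Ω := ⟨I, hI, h.symm ▸ hq⟩
    rw [← h, hGext I hI _ hz, hext I hI _ hz, hF.eqOn hD hx hFs hG hGs hr ht hFr hGt hz]
end
end
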